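/- arXiv:2411.08270 — 2 statements merged into one kernel-verified Lean document; each statement's English description precedes it below -/
import Mathlib

section
/- Let p be a prime and a = a'·c with a' ≥ 1 and c ≥ 2, and set q = p^a. Let σ: 𝔽_q → 𝔽_q be the field automorphism x ↦ x^{p^{a'}}, and define ρ: SL₂(𝔽_q) → GL₄(𝔽_q) by ρ(h) = h ⊗ σ(h), the Kronecker product of h with the matrix obtained by applying σ to every entry of h. Then for an odd prime r, the image ρ(SL₂(𝔽_q)) contains a 2-stingray element of order r if and only if c is odd (hence c ≥ 3) and r divides p^{a'} + 1; moreover every such prime r is a primitive prime divisor of q² − 1. -/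
/-- A linear endomorphism `g` of an `F`-vector space `M` is an `e`-stingray element if
`M = U ⊕ Fix(g)` where `Fix(g)` is the fixed-point subspace of `g` and `U` is a
`g`-invariant subspace of dimension `e` on which `g` acts irreducibly. -/
def IsStingrayOn (F : Type*) [Field F] {M : Type*} [AddCommGroup M] [Module F M]
    (g : Module.End F M) (e : ℕ) : Prop :=
  ∃ U : Submodule F M,
    Module.finrank F ↥U = e ∧
    Submodule.map g U ≤ U ∧
    IsCompl U (LinearMap.ker (g - LinearMap.id)) ∧
    ∀ W : Submodule F M, W ≤ U → Submodule.map g W ≤ W → W = ⊥ ∨ W = U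

/-- The twisted tensor product representation `ρ(h) = h ⊗ σ(h)` of `SL₂(𝔽_q)` on
`𝔽_q⁴`, where `σ : x ↦ x^t` is applied entrywise to `h` and `⊗` is the Kronecker
product; here it is viewed as a linear endomorphism of `𝔽_q⁴ = (Fin 2 × Fin 2 → 𝔽_q)`. -/
noncomputable def twistedTensor (F : Type*) [Field F] (t : ℕ)
    (h : Matrix.SpecialLinearGroup (Fin 2) F) :
    Module.End F (Fin 2 × Fin 2 → F) :=
  (Matrix.kroneckerMap (· * ·) (h : Matrix (Fin 2) (Fin 2) F)
    ((h : Matrix (Fin 2) (Fin 2) F).map (fun x => x ^ t))).mulVecLin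

section QuadraticRelations

variable {F : Type*} [Field F]

/-- A solution of a quadratic equation without roots in `F` generates a copy of the corresponding
quadratic extension, so it satisfies `x ^ n = 1` as soon as a root in some extension does. -/
theorem pow_eq_one_of_quadratic {K A : Type*} [Field K] [Algebra F K] [Ring A] [Algebra F A]
    {s : F} (hs : ∀ x : F, x * x - s * x + 1 ≠ 0) {y : K}
    (hy : y * y - algebraMap F K s * y + 1 = 0) {b : A} (hb : b * b - s • b + 1 = 0)
    {n : ℕ} (hn : y ^ n = 1) : b ^ n = 1 := by
  open Polynomial in
  set f : F[X] := X ^ 2 - C s * X + 1 with hf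
  have hdeg : f.natDegree = 2 := by rw [hf]; compute_degree!
  have hmonic : f.Monic := by rw [hf]; monicity!
  have hirr : Irreducible f := by
    refine irreducible_of_degree_le_three_of_not_isRoot (by simp [hdeg]) fun x hx => hs x ?_
    simpa [hf, IsRoot, pow_two] using hx
  have hfy : aeval y f = 0 := by simpa [hf, pow_two] using hy
  have hfb : aeval b f = 0 := by simpa [hf, pow_two, Algebra.smul_def] using hb
  have hdvd : f ∣ X ^ n - 1 := by
    rw [minpoly.eq_of_irreducible_of_monic hirr hfy hmonic]
    exact minpoly.dvd _ _ (by simp [hn])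
  obtain ⟨k, hk⟩ := hdvd
  have := congrArg (aeval b) hk
  simpa [hfb, sub_eq_zero] using this

/-- If `T` commutes with `g`, preserves a subspace `U` on which `g` acts irreducibly, and satisfies
a quadratic equation with a root in the ground field, then `T` is scalar on `U`. -/
theorem exists_eq_smul_of_quadratic {V : Type*} [AddCommGroup V] [Module F V]
    {g T : Module.End F V} {U : Submodule F V} (hgU : Submodule.map g U ≤ U)
    (hirr : ∀ W : Submodule F V, W ≤ U → Submodule.map g W ≤ W → W = ⊥ ∨ W = U)
    (hTU : ∀ u ∈ U, T u ∈ U) (hcomm : Commute g T) {s x : F}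
    (hT : T * T - s • T + 1 = 0) (hx : x * x - s * x + 1 = 0) :
    ∃ α : F, ∀ u ∈ U, T u = α • u := by
  have hgT : ∀ v, g (T v) = T (g v) := fun v => LinearMap.congr_fun hcomm v
  have hTT : ∀ v, T (T v) = s • T v - v := fun v => by
    have := LinearMap.congr_fun hT v
    simp only [LinearMap.add_apply, LinearMap.sub_apply, Module.End.mul_apply,
      LinearMap.smul_apply, Module.End.one_apply, LinearMap.zero_apply] at this
    rw [← sub_eq_zero, ← this]; abel
  have hinv : Submodule.map g (U ⊓ LinearMap.ker (T - x • LinearMap.id)) ≤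
      U ⊓ LinearMap.ker (T - x • LinearMap.id) := by
    rintro _ ⟨u, ⟨hu, hk⟩, rfl⟩
    have hk' : T u = x • u := by simpa [sub_eq_zero] using hk
    refine ⟨hgU ⟨u, hu, rfl⟩, ?_⟩
    simp [← hgT, hk']
  rcases hirr _ inf_le_left hinv with h | h
  · refine ⟨s - x, fun u hu => ?_⟩
    have hmem : T u - (s - x) • u ∈ U ⊓ LinearMap.ker (T - x • LinearMap.id) := by
      refine ⟨U.sub_mem (hTU u hu) (U.smul_mem _ hu), LinearMap.mem_ker.2 ?_⟩
      simp only [LinearMap.sub_apply, LinearMap.smul_apply, LinearMap.id_apply,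
        map_sub, map_smul, hTT]
      have : (x * x - s * x + 1) • u = 0 := by rw [hx, zero_smul]
      rw [← neg_eq_zero, ← this]
      module
    rw [h, Submodule.mem_bot, sub_eq_zero] at hmem
    exact hmem
  · refine ⟨x, fun u hu => ?_⟩
    have hmem := (h.symm ▸ hu : u ∈ U ⊓ LinearMap.ker (T - x • LinearMap.id)).2
    simpa [sub_eq_zero] using hmem

/-- If a product of two commuting solutions of quadratic equations with constant term `1` is a
`2`-stingray element with non-trivial fixed space, then both equations agree and have no root in
the ground field. -/
theorem IsStingrayOn.quadratic {V : Type*} [AddCommGroup V] [Module F V] [FiniteDimensional F V]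
    {H S : Module.End F V} (hcomm : Commute H S) {s s' : F}
    (hH : H * H - s • H + 1 = 0) (hS : S * S - s' • S + 1 = 0)
    (hroots : ∀ x : F, x * x - s * x + 1 = 0 → ∃ y : F, y * y - s' * y + 1 = 0)
    (hst : IsStingrayOn F (H * S) 2) (hV : 2 < Module.finrank F V) :
    s' = s ∧ ∀ x : F, x * x - s * x + 1 ≠ 0 := by
  obtain ⟨U, hU2, hgU, hcompl, hirr⟩ := hst
  set g := H * S with hg
  have hgH : Commute g H := (Commute.refl H).mul_left hcomm.symm
  have hgS : Commute g S := hcomm.mul_left (Commute.refl S)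
  have hrange : LinearMap.range (g - LinearMap.id) = U := by
    refine Submodule.eq_of_le_of_finrank_eq ?_ ?_
    · rintro _ ⟨v, rfl⟩
      obtain ⟨u, hu, w, hw, rfl⟩ := Submodule.mem_sup.1
        (hcompl.sup_eq_top ▸ Submodule.mem_top : v ∈ U ⊔ LinearMap.ker (g - LinearMap.id))
      rw [map_add, LinearMap.mem_ker.1 hw, add_zero]
      exact U.sub_mem (hgU ⟨u, hu, rfl⟩) hu
    · have h1 := (g - LinearMap.id).finrank_range_add_finrank_ker
      have h2 := Submodule.finrank_add_eq_of_isCompl hcompl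
      omega
  have hpres : ∀ T : Module.End F V, Commute g T → ∀ u ∈ U, T u ∈ U := by
    intro T hT u hu
    rw [← hrange] at hu ⊢
    obtain ⟨v, rfl⟩ := hu
    refine ⟨T v, ?_⟩
    have : g (T v) = T (g v) := LinearMap.congr_fun hT v
    simp [this]
  refine ⟨?_, fun x hx => ?_⟩
  · have hpos : 0 < Module.finrank F (LinearMap.ker (g - LinearMap.id)) := by
      have h2 := Submodule.finrank_add_eq_of_isCompl hcompl
      omega
    have : Nontrivial (LinearMap.ker (g - LinearMap.id)) := Module.nontrivial_of_finrank_pos hpos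
    obtain ⟨⟨v, hv⟩, hv0⟩ := exists_ne (0 : LinearMap.ker (g - LinearMap.id))
    have hv0' : v ≠ 0 := fun h => hv0 (Subtype.ext h)
    have hHS : H (S v) = v := by simpa [sub_eq_zero, hg] using hv
    have hSH : S (H v) = v := (LinearMap.congr_fun hcomm v).symm.trans hHS
    have eH := LinearMap.congr_fun hH (S v)
    have eS := LinearMap.congr_fun hS (H v)
    simp only [LinearMap.add_apply, LinearMap.sub_apply, Module.End.mul_apply,
      LinearMap.smul_apply, Module.End.one_apply, LinearMap.zero_apply, hHS, hSH] at eH eS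
    have : (s' - s) • v = 0 := by
      rw [sub_smul, ← sub_eq_zero.2 (eH.trans eS.symm)]; abel
    exact sub_eq_zero.1 ((smul_eq_zero.1 this).resolve_right hv0')
  · obtain ⟨y, hy⟩ := hroots x hx
    obtain ⟨α, hα⟩ := exists_eq_smul_of_quadratic hgU hirr (hpres H hgH) hgH hH hx
    obtain ⟨β, hβ⟩ := exists_eq_smul_of_quadratic hgU hirr (hpres S hgS) hgS hS hy
    have : Nontrivial U := Module.nontrivial_of_finrank_pos (R := F) (by omega)
    obtain ⟨⟨u, hu⟩, hu0⟩ := exists_ne (0 : U)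
    have hu0' : u ≠ 0 := fun h => hu0 (Subtype.ext h)
    have hline : Submodule.span F {u} ≤ U := by simpa using hu
    have hinv : Submodule.map g (Submodule.span F {u}) ≤ Submodule.span F {u} := by
      rintro _ ⟨w, hw, rfl⟩
      have : g w = (β * α) • w := by
        simp [hg, hβ w (hline hw), hα w (hline hw), mul_smul]
      rw [this]
      exact Submodule.smul_mem _ _ hw
    rcases hirr _ hline hinv with h | h
    · exact hu0' (Submodule.span_singleton_eq_bot.1 h)
    · rw [← h, finrank_span_singleton hu0'] at hU2
      omega

end QuadraticRelations

section Frobenius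

theorem pow_pow_eq_ite_of_pow_eq_inv {K : Type*} [Field K] {y : K} {t : ℕ} (hy : y ^ t = y⁻¹)
    (c : ℕ) : y ^ t ^ c = if Even c then y else y⁻¹ := by
  induction c with
  | zero => simp
  | succ c ih =>
    rw [pow_succ, pow_mul, ih]
    by_cases h : Even c <;> simp [h, Nat.even_add_one, hy]

theorem mem_range_algebraMap_of_pow_card_eq {F K : Type*} [Field F] [Fintype F] [Field K]
    [Algebra F K] {y : K} (hy : y ^ Fintype.card F = y) : ∃ x : F, algebraMap F K x = y := by
  open Polynomial in
  have h1 : (X ^ Fintype.card F - X : F[X]) = ∏ a : F, (X - C a) := by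
    have hq := Fintype.one_lt_card (α := F)
    have hr := FiniteField.roots_X_pow_card_sub_X F
    have hd := FiniteField.X_pow_card_sub_X_natDegree_eq F hq
    refine (prod_multiset_X_sub_C_of_monic_of_roots_card_eq ?_ ?_).symm.trans ?_
    · exact monic_X_pow_sub (by simpa using hq)
    · rw [hr, hd]; rfl
    · rw [hr]; rfl
  have h2 := congrArg (aeval y) h1
  simp only [map_sub, map_pow, aeval_X, hy, sub_self, map_prod, aeval_C] at h2
  obtain ⟨a, -, ha⟩ := Finset.prod_eq_zero_iff.1 h2.symm
  exact ⟨a, (sub_eq_zero.1 ha).symm⟩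

theorem odd_and_pow_eq_one_of_quadratic {F K : Type*} [Field F] [Fintype F] [Field K]
    [Algebra F K] {p k c : ℕ} [CharP F p] (hp : p.Prime) (hF : Fintype.card F = (p ^ k) ^ c)
    {s : F} (hst : s ^ p ^ k = s) (hs : ∀ x : F, x * x - s * x + 1 ≠ 0) {y : K}
    (hy : y * y - algebraMap F K s * y + 1 = 0) : Odd c ∧ y ^ (p ^ k + 1) = 1 := by
  have : Fact p.Prime := ⟨hp⟩
  have : CharP K p := charP_of_injective_algebraMap (algebraMap F K).injective p
  have hyF : y ^ Fintype.card F ≠ y := fun h => by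
    obtain ⟨x, rfl⟩ := mem_range_algebraMap_of_pow_card_eq h
    refine hs x ((algebraMap F K).injective ?_)
    simpa using hy
  have hy0 : y ≠ 0 := by rintro rfl; simp at hy
  set S := algebraMap F K s with hS
  have hSt : S ^ p ^ k = S := by rw [hS, ← map_pow, hst]
  have hfrob : y ^ p ^ k * y ^ p ^ k - S * y ^ p ^ k + 1 = 0 := by
    have := congrArg (iterateFrobenius K p k) hy
    simpa only [map_add, map_sub, map_mul, map_one, map_zero, iterateFrobenius_def, hSt] using this
  have hfac : (y ^ p ^ k - y) * (y ^ p ^ k - (S - y)) = 0 := by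
    linear_combination hfrob - hy
  have hinv : y ^ p ^ k = y⁻¹ := by
    rcases mul_eq_zero.1 hfac with h | h
    · exfalso
      have h' := sub_eq_zero.1 h
      refine hyF ?_
      rw [hF]
      clear * - h'
      induction c with
      | zero => simp
      | succ c ih => rw [pow_succ, pow_mul, ih, h']
    · rw [sub_eq_zero.1 h]
      refine eq_inv_of_mul_eq_one_left ?_
      linear_combination -hy
  refine ⟨?_, by rw [pow_succ, hinv, inv_mul_cancel₀ hy0]⟩
  by_contra hc
  rw [Nat.not_odd_iff_even] at hc
  exact hyF (by rw [hF, pow_pow_eq_ite_of_pow_eq_inv hinv, if_pos hc])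

end Frobenius

section TwistedTensor

variable {F : Type*} [Field F]

theorem Matrix.SpecialLinearGroup.quadratic (h : Matrix.SpecialLinearGroup (Fin 2) F) :
    (h : Matrix (Fin 2) (Fin 2) F) * h - (h : Matrix (Fin 2) (Fin 2) F).trace • h.1 + 1 = 0 := by
  have := Matrix.aeval_self_charpoly (h : Matrix (Fin 2) (Fin 2) F)
  rw [Matrix.charpoly_fin_two, h.det_coe] at this
  simpa [pow_two, Algebra.smul_def] using this

open scoped Kronecker in
theorem twistedTensor_eq_mul (p k : ℕ) [Fact p.Prime] [CharP F p]
    (h : Matrix.SpecialLinearGroup (Fin 2) F) :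
    ∃ H S : Module.End F (Fin 2 × Fin 2 → F), twistedTensor F (p ^ k) h = H * S ∧ Commute H S ∧
      H * H - (h : Matrix (Fin 2) (Fin 2) F).trace • H + 1 = 0 ∧
      S * S - ((h : Matrix (Fin 2) (Fin 2) F).trace ^ p ^ k) • S + 1 = 0 := by
  set A : Matrix (Fin 2) (Fin 2) F := h.1 with hA
  have hAq : A * A - A.trace • A + 1 = 0 := h.quadratic
  set B : Matrix (Fin 2) (Fin 2) F := A.map (fun x => x ^ p ^ k) with hB
  have hBq : B * B - (A.trace ^ p ^ k) • B + 1 = 0 := by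
    have hm : (iterateFrobenius F p k).mapMatrix A = B := by
      ext i j; simp [hB, iterateFrobenius_def]
    have := congrArg (iterateFrobenius F p k).mapMatrix hAq
    rw [map_add, map_sub, map_mul, map_one, map_zero, hm] at this
    rw [← this, ← hm]
    congr 2
    ext i j
    simp [iterateFrobenius_def, mul_pow]
  have hHM : (A ⊗ₖ (1 : Matrix (Fin 2) (Fin 2) F)) * (A ⊗ₖ 1) - A.trace • (A ⊗ₖ 1) + 1 = 0 := by
    have : (A * A - A.trace • A + 1) ⊗ₖ (1 : Matrix (Fin 2) (Fin 2) F) = 0 := by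
      rw [hAq, Matrix.zero_kronecker]
    rw [← this, ← Matrix.mul_kronecker_mul, mul_one,
      Matrix.add_kronecker, Matrix.one_kronecker_one, sub_eq_add_neg, sub_eq_add_neg,
      ← neg_smul, ← neg_smul, Matrix.add_kronecker, Matrix.smul_kronecker]
  have hSM : ((1 : Matrix (Fin 2) (Fin 2) F) ⊗ₖ B) * (1 ⊗ₖ B) - (A.trace ^ p ^ k) • (1 ⊗ₖ B) + 1
      = 0 := by
    have : (1 : Matrix (Fin 2) (Fin 2) F) ⊗ₖ (B * B - (A.trace ^ p ^ k) • B + 1) = 0 := by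
      rw [hBq, Matrix.kronecker_zero]
    rw [← this, ← Matrix.mul_kronecker_mul, mul_one, Matrix.kronecker_add,
      Matrix.one_kronecker_one, sub_eq_add_neg, sub_eq_add_neg, ← neg_smul, ← neg_smul,
      Matrix.kronecker_add, Matrix.kronecker_smul]
  refine ⟨Matrix.toLinAlgEquiv' (A ⊗ₖ 1), Matrix.toLinAlgEquiv' (1 ⊗ₖ B), ?_, ?_, ?_, ?_⟩
  · rw [← map_mul, ← Matrix.mul_kronecker_mul, mul_one, one_mul]
    rfl
  · rw [Commute, SemiconjBy, ← map_mul, ← map_mul, ← Matrix.mul_kronecker_mul,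
      ← Matrix.mul_kronecker_mul]
    simp
  · simpa only [map_add, map_sub, map_mul, map_smul, map_one, map_zero] using
      congrArg Matrix.toLinAlgEquiv' hHM
  · simpa only [map_add, map_sub, map_mul, map_smul, map_one, map_zero] using
      congrArg Matrix.toLinAlgEquiv' hSM

/-- The coordinate form of `h ⊗ h` for the companion matrix `h` of `X² - s X + 1`: it is a
`2`-stingray element as soon as `X² - (s² - 2) X + 1` has no root in the ground field. -/
theorem isStingrayOn_two_of_apply {g : Module.End F (Fin 2 × Fin 2 → F)} {s : F}
    (hg : ∀ v, g v = fun i => !![v (1, 1), -v (1, 0) - s * v (1, 1);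
      -v (0, 1) - s * v (1, 1), v (0, 0) + s * v (1, 0) + s * v (0, 1) + s * s * v (1, 1)] i.1 i.2)
    (hirr : ∀ x : F, x * x - (s * s - 2) * x + 1 ≠ 0) : IsStingrayOn F g 2 := by
  let φ : F × F →ₗ[F] (Fin 2 × Fin 2 → F) :=
    { toFun := fun v i => !![v.1, v.2; v.2, -v.1 - s * v.2] i.1 i.2
      map_add' := fun v w => by ext ⟨i, j⟩; fin_cases i <;> fin_cases j <;> simp; ring
      map_smul' := fun m v => by ext ⟨i, j⟩; fin_cases i <;> fin_cases j <;> simp; ring }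
  let ψ : F × F →ₗ[F] (Fin 2 × Fin 2 → F) :=
    { toFun := fun v i => !![v.1, v.2; -v.2 - s * v.1, v.1] i.1 i.2
      map_add' := fun v w => by ext ⟨i, j⟩; fin_cases i <;> fin_cases j <;> simp; ring
      map_smul' := fun m v => by ext ⟨i, j⟩; fin_cases i <;> fin_cases j <;> simp; ring }
  have hφi : Function.Injective φ := fun v w h =>
    Prod.ext (congrFun h (0, 0)) (congrFun h (0, 1))
  have hψi : Function.Injective ψ := fun v w h =>
    Prod.ext (congrFun h (0, 0)) (congrFun h (0, 1))
  have hs4 : s * s - 4 ≠ 0 := fun h => hirr 1 (by linear_combination -h)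
  have hgφ : ∀ v, g (φ v) = φ (-v.1 - s * v.2, s * v.1 + (s * s - 1) * v.2) := fun v => by
    rw [hg]
    ext ⟨i, j⟩
    fin_cases i <;> fin_cases j <;> simp [φ] <;> ring
  have hgψ : ∀ v, g (ψ v) = ψ v := fun v => by
    rw [hg]
    ext ⟨i, j⟩
    fin_cases i <;> fin_cases j <;> simp [ψ]; ring
  have hφ2 : Module.finrank F (LinearMap.range φ) = 2 := by
    rw [LinearMap.finrank_range_of_inj hφi]; simp
  have hψ2 : Module.finrank F (LinearMap.range ψ) = 2 := by
    rw [LinearMap.finrank_range_of_inj hψi]; simp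
  have hker : LinearMap.range ψ ≤ LinearMap.ker (g - LinearMap.id) := by
    rintro _ ⟨v, rfl⟩
    simp [hgψ]
  have hdisj : Disjoint (LinearMap.range φ) (LinearMap.ker (g - LinearMap.id)) := by
    rw [Submodule.disjoint_def]
    rintro _ ⟨v, rfl⟩ hv
    have hv' : φ (-v.1 - s * v.2, s * v.1 + (s * s - 1) * v.2) = φ v := by
      rw [← hgφ]; simpa [sub_eq_zero] using hv
    have h1 := congrArg Prod.fst (hφi hv')
    have h2 := congrArg Prod.snd (hφi hv')
    simp only at h1 h2
    have e1 : v.1 = 0 := (mul_eq_zero.1 (by linear_combination (2 - s * s) * h1 - s * h2 :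
      (s * s - 4) * v.1 = 0)).resolve_left hs4
    have e2 : v.2 = 0 := (mul_eq_zero.1 (by linear_combination s * h1 + 2 * h2 :
      (s * s - 4) * v.2 = 0)).resolve_left hs4
    rw [show v = 0 from Prod.ext e1 e2, map_zero]
  refine ⟨LinearMap.range φ, hφ2, ?_, ⟨hdisj, ?_⟩, fun W hW hgW => ?_⟩
  · rintro _ ⟨_, ⟨v, rfl⟩, rfl⟩
    exact ⟨_, (hgφ v).symm⟩
  · rw [codisjoint_iff]
    refine Submodule.eq_top_of_disjoint _ _ ?_ hdisj
    have := Submodule.finrank_mono hker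
    simp
    omega
  · have hle := Submodule.finrank_mono hW
    rw [hφ2] at hle
    obtain h | h | h : Module.finrank F W = 0 ∨ Module.finrank F W = 1 ∨ Module.finrank F W = 2 := by
      omega
    · exact Or.inl (Submodule.finrank_eq_zero.1 h)
    · exfalso
      obtain ⟨⟨w, hw⟩, hw0, hspan⟩ := finrank_eq_one_iff'.1 h
      obtain ⟨v, rfl⟩ := hW hw
      obtain ⟨x, hx⟩ := hspan ⟨_, hgW ⟨_, hw, rfl⟩⟩
      have hx' : φ (x • v) = φ (-v.1 - s * v.2, s * v.1 + (s * s - 1) * v.2) := by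
        rw [map_smul, ← hgφ]; exact congrArg Subtype.val hx
      have h1 := congrArg Prod.fst (hφi hx')
      have h2 := congrArg Prod.snd (hφi hx')
      simp only [Prod.smul_fst, Prod.smul_snd, smul_eq_mul] at h1 h2
      have e1 : v.1 = 0 := (mul_eq_zero.1 (by linear_combination (x - (s * s - 1)) * h1 - s * h2 :
        (x * x - (s * s - 2) * x + 1) * v.1 = 0)).resolve_left (hirr x)
      have e2 : v.2 = 0 := (mul_eq_zero.1 (by linear_combination s * h1 + (x + 1) * h2 :
        (x * x - (s * s - 2) * x + 1) * v.2 = 0)).resolve_left (hirr x)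
      exact hw0 (Subtype.ext ((congrArg φ (Prod.ext e1 e2 : v = 0)).trans (map_zero φ)))
    · exact Or.inr (Submodule.eq_of_le_of_finrank_eq hW (h.trans hφ2.symm))

end TwistedTensor

/-- A divisor of `p ^ k + 1` divides `p ^ (k * c) + 1` for odd `c`. -/
theorem dvd_pow_mul_add_one_of_odd {p k c r : ℕ} (hc : Odd c) (h : r ∣ p ^ k + 1) :
    r ∣ p ^ (k * c) + 1 := by
  rw [pow_mul]
  simpa using h.trans (hc.nat_add_dvd_pow_add_pow (p ^ k) 1)

theorem exists_twistedTensor_isStingrayOn {F : Type*} [Field F] [Fintype F] {p k c r : ℕ}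
    (hp : p.Prime) [CharP F p] (hk : k ≠ 0) (hF : Fintype.card F = p ^ (k * c)) (hc : Odd c)
    (hr : r.Prime) (hrodd : Odd r) (hrt : r ∣ p ^ k + 1) :
    ∃ h : Matrix.SpecialLinearGroup (Fin 2) F, IsStingrayOn F (twistedTensor F (p ^ k) h) 2 ∧
      orderOf (twistedTensor F (p ^ k) h) = r := by
  have : Fact p.Prime := ⟨hp⟩
  have : Fact r.Prime := ⟨hr⟩
  let K := AlgebraicClosure F
  have : CharP K p := charP_of_injective_algebraMap (algebraMap F K).injective p
  have hrp : r ≠ p := by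
    rintro rfl
    exact hr.one_lt.ne' (Nat.dvd_one.1 ((Nat.dvd_add_right (dvd_pow_self r hk)).1 hrt))
  have : NeZero (r : K) := ⟨fun h => hrp ((Nat.prime_dvd_prime_iff_eq hp hr).1
    ((CharP.cast_eq_zero_iff K p r).1 h)).symm⟩
  obtain ⟨y, hy⟩ := HasEnoughRootsOfUnity.exists_primitiveRoot K r
  have hy0 : y ≠ 0 := hy.ne_zero hr.ne_zero
  have hyy : y * y⁻¹ = 1 := mul_inv_cancel₀ hy0
  have hinv : ∀ n, r ∣ n + 1 → y ^ n = y⁻¹ := fun n hn =>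
    eq_inv_of_mul_eq_one_left (by rw [← pow_succ, (hy.pow_eq_one_iff_dvd _).2 hn])
  have ht : y ^ p ^ k = y⁻¹ := hinv _ hrt
  have hq : y ^ Fintype.card F = y⁻¹ := hF ▸ hinv _ (dvd_pow_mul_add_one_of_odd hc hrt)
  have hr3 : 3 ≤ r := by
    have := hr.two_le
    rcases hrodd with ⟨m, rfl⟩
    omega
  have hr4 : ¬ r ∣ 4 := fun h => by
    have h2 : r ∣ 2 := hr.dvd_of_dvd_pow (n := 2) (by simpa using h)
    exact absurd (Nat.le_of_dvd two_pos h2) (by omega)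
  have hr2 : ¬ r ∣ 2 := fun h => hr4 (h.trans (by norm_num))
  obtain ⟨s, hsy⟩ : ∃ s : F, algebraMap F K s = y + y⁻¹ := by
    refine mem_range_algebraMap_of_pow_card_eq ?_
    rw [hF, add_pow_char_pow, ← hF, inv_pow, hq, inv_inv, add_comm]
  have hst : s ^ p ^ k = s := by
    refine (algebraMap F K).injective ?_
    rw [map_pow, hsy, add_pow_char_pow, inv_pow, ht, inv_inv, add_comm]
  have hpow : ∀ n, ¬ r ∣ 2 * n → ∀ x : F, algebraMap F K x ≠ y ^ n := fun n hn x hx => hn <| by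
    have h : (y ^ n) ^ Fintype.card F = y ^ n := by
      rw [← hx, ← map_pow, FiniteField.pow_card]
    rw [← pow_mul, mul_comm, pow_mul, hq, inv_pow] at h
    refine (hy.pow_eq_one_iff_dvd _).1 ?_
    rw [two_mul, pow_add]
    nth_rewrite 1 [← h]
    exact inv_mul_cancel₀ (pow_ne_zero _ hy0)
  have hpow' : ∀ n, ¬ r ∣ 2 * n → ∀ x : F, algebraMap F K x ≠ (y ^ n)⁻¹ := fun n hn x hx =>
    hpow n hn x⁻¹ (by rw [map_inv₀, hx, inv_inv])
  have hs : ∀ x : F, x * x - s * x + 1 ≠ 0 := fun x hx => by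
    have h := congrArg (algebraMap F K) hx
    simp only [map_add, map_sub, map_mul, map_one, map_zero, hsy] at h
    have h' : (algebraMap F K x - y ^ 1) * (algebraMap F K x - (y ^ 1)⁻¹) = 0 := by
      linear_combination h + hyy
    rcases mul_eq_zero.1 h' with h' | h'
    · exact hpow 1 (by simpa using hr2) x (sub_eq_zero.1 h')
    · exact hpow' 1 (by simpa using hr2) x (sub_eq_zero.1 h')
  have hs2 : ∀ x : F, x * x - (s * s - 2) * x + 1 ≠ 0 := fun x hx => by
    have h := congrArg (algebraMap F K) hx
    simp only [map_add, map_sub, map_mul, map_one, map_zero, hsy, map_ofNat] at h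
    have h' : (algebraMap F K x - y ^ 2) * (algebraMap F K x - (y ^ 2)⁻¹) = 0 := by
      rw [← inv_pow]
      linear_combination h + (y * y⁻¹ + 1 + 2 * algebraMap F K x) * hyy
    rcases mul_eq_zero.1 h' with h' | h'
    · exact hpow 2 (by simpa using hr4) x (sub_eq_zero.1 h')
    · exact hpow' 2 (by simpa using hr4) x (sub_eq_zero.1 h')
  let h : Matrix.SpecialLinearGroup (Fin 2) F := ⟨!![0, -1; 1, s], by simp⟩
  have hst' : IsStingrayOn F (twistedTensor F (p ^ k) h) 2 := by
    refine isStingrayOn_two_of_apply (s := s) (fun v => ?_) hs2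
    have hneg : (-1 : F) ^ p ^ k = -1 := by
      simpa [iterateFrobenius_def] using map_neg (iterateFrobenius F p k) 1
    ext ⟨i, j⟩
    fin_cases i <;> fin_cases j <;>
      simp [twistedTensor, h, Matrix.mulVec, dotProduct, Fintype.sum_prod_type, hst, hneg,
        hp.ne_zero] <;> ring
  refine ⟨h, hst', orderOf_eq_prime ?_ ?_⟩
  · obtain ⟨H, S, hHS, hcomm, hH, hS⟩ := twistedTensor_eq_mul p k h
    have htr : (h : Matrix (Fin 2) (Fin 2) F).trace = s := by simp [h, Matrix.trace_fin_two]
    rw [htr] at hH hS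
    rw [hst] at hS
    have hyq : y * y - algebraMap F K s * y + 1 = 0 := by 
      rw [hsy]; linear_combination -hyy
    rw [hHS, hcomm.mul_pow, pow_eq_one_of_quadratic hs hyq hH hy.pow_eq_one,
      pow_eq_one_of_quadratic hs hyq hS hy.pow_eq_one, one_mul]
  · intro h1
    obtain ⟨U, hU2, -, hcompl, -⟩ := hst'
    rw [h1, Module.End.one_eq_id, sub_self, LinearMap.ker_zero] at hcompl
    rw [eq_bot_of_isCompl_top hcompl, finrank_bot] at hU2
    omega

/-- Let `p` be prime, `a = a'·c` with `a' ≥ 1`, `c ≥ 2`, `q = p^a`, and let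
`ρ : SL₂(𝔽_q) → GL₄(𝔽_q)`, `ρ(h) = h ⊗ σ(h)` where `σ : x ↦ x^{p^{a'}}`.  Then for an
odd prime `r`, the image of `ρ` contains a `2`-stingray element of order `r` if and only
if `c` is odd and `r ∣ p^{a'} + 1`; moreover every such prime `r` is a primitive prime
divisor of `q² - 1`. -/
theorem stmt17 (p a' c : ℕ) (hp : p.Prime) (ha' : 1 ≤ a') (hc : 2 ≤ c)
    (q : ℕ) (hq : q = p ^ (a' * c))
    (F : Type*) [Field F] [Fintype F] (hF : Fintype.card F = q)
    (r : ℕ) (hr : r.Prime) (hrodd : Odd r) :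
    ((∃ h : Matrix.SpecialLinearGroup (Fin 2) F,
        IsStingrayOn F (twistedTensor F (p ^ a') h) 2 ∧
        orderOf (twistedTensor F (p ^ a') h) = r) ↔
      (Odd c ∧ r ∣ p ^ a' + 1)) ∧
    (Odd c → r ∣ p ^ a' + 1 → (r ∣ q ^ 2 - 1 ∧ ¬ r ∣ q - 1)) := by
  have : Fact p.Prime := ⟨hp⟩
  have hcardp : Fintype.card F = p ^ (a' * c) := hF.trans hq
  have : CharP F p := charP_of_card_eq_prime_pow hcardp
  refine ⟨⟨?_, fun ⟨hcodd, hrt⟩ =>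
    exists_twistedTensor_isStingrayOn hp (by omega) hcardp hcodd hr hrodd hrt⟩, fun hcodd hrt => ?_⟩
  · rintro ⟨h, hst, hord⟩
    obtain ⟨H, S, hHS, hcomm, hH, hS⟩ := twistedTensor_eq_mul p a' h
    rw [hHS] at hst hord
    obtain ⟨hss, hroots⟩ := hst.quadratic hcomm hH hS (fun x hx => ⟨x ^ p ^ a', by
      have := congrArg (iterateFrobenius F p a') hx
      simpa only [map_add, map_sub, map_mul, map_one, map_zero, iterateFrobenius_def] using this⟩)
      (by simp)
    rw [hss] at hS
    set s := (h : Matrix (Fin 2) (Fin 2) F).trace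
    let K := AlgebraicClosure F
    obtain ⟨y, hy⟩ : ∃ y : K, y * y - algebraMap F K s * y + 1 = 0 := by
      open Polynomial in
      obtain ⟨y, hy⟩ := IsAlgClosed.exists_root (X ^ 2 - C (algebraMap F K s) * X + 1 : K[X])
        (by
          have : (X ^ 2 - C (algebraMap F K s) * X + 1 : K[X]).degree = 2 := by compute_degree!
          rw [this]; norm_num)
      exact ⟨y, by simpa [IsRoot, pow_two] using hy⟩
    obtain ⟨hodd, hpow⟩ :=
      odd_and_pow_eq_one_of_quadratic hp (by rw [hcardp, pow_mul]) hss hroots hy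
    refine ⟨hodd, hord ▸ orderOf_dvd_of_pow_eq_one ?_⟩
    rw [hcomm.mul_pow, pow_eq_one_of_quadratic hroots hy hH hpow,
      pow_eq_one_of_quadratic hroots hy hS hpow, one_mul]
  · have hq1 : r ∣ q + 1 := hq ▸ dvd_pow_mul_add_one_of_odd hcodd hrt
    have hqpos : 1 ≤ q := hq ▸ Nat.one_le_pow _ _ hp.pos
    refine ⟨?_, fun hd => ?_⟩
    · rw [← one_pow 2, Nat.sq_sub_sq]
      exact hq1.mul_right _
    · have h2 : r ∣ 2 := by
        have := Nat.dvd_sub hq1 hd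
        rwa [show q + 1 - (q - 1) = 2 by omega] at this
      have h3 := (Nat.prime_dvd_prime_iff_eq hr Nat.prime_two).1 h2
      subst h3
      exact absurd hrodd (by decide)
end

section
/- Let q be a prime power and m ≥ 3 an integer, and let SU_m(q) ≤ GL_m(𝔽_{q²}) be the special unitary group: the group of determinant-1 matrices preserving the nondegenerate Hermitian form β(u, v) = Σᵢ uᵢ vᵢ^q on 𝔽_{q²}^m, Hermitian with respect to the involutory field automorphism x ↦ x^q of 𝔽_{q²}. If ρ: SU_m(q) → GL_m(𝔽_{q²}) is a faithful group homomorphism for which 𝔽_{q²}^m is an irreducible 𝔽_{q²}[SU_m(q)]-module under the action induced by ρ, then the image ρ(SU_m(q)) preserves a nondegenerate Hermitian form on 𝔽_{q²}^m (with respect to x ↦ x^q), and hence ρ(SU_m(q)) is conjugate in GL_m(𝔽_{q²}) to SU_m(q). -/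
/-- The standard Hermitian form `β(u, v) = ∑ᵢ uᵢ vᵢ^q` on `K^m`, where `K = 𝔽_{q²}` and
`x ↦ x^q` is the involutory field automorphism of `K`. -/
def stdHerm (K : Type*) [Field K] (q m : ℕ) (u v : Fin m → K) : K :=
  ∑ i, u i * (v i) ^ q

/-- The special unitary group `SU_m(q) ≤ GL_m(𝔽_{q²})`: determinant-one matrices
preserving the standard Hermitian form. -/
def SUgroup (K : Type*) [Field K] (q m : ℕ) :
    Subgroup (Matrix.GeneralLinearGroup (Fin m) K) where
  carrier := {g | Matrix.det (g : Matrix (Fin m) (Fin m) K) = 1 ∧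
    ∀ u v, stdHerm K q m (Matrix.mulVec (g : Matrix (Fin m) (Fin m) K) u)
      (Matrix.mulVec (g : Matrix (Fin m) (Fin m) K) v) = stdHerm K q m u v}
  one_mem' := by
    constructor
    · rw [Units.val_one, Matrix.det_one]
    · intro u v
      rw [Units.val_one, Matrix.one_mulVec, Matrix.one_mulVec]
  mul_mem' := by
    rintro g h ⟨hgd, hgf⟩ ⟨hhd, hhf⟩
    constructor
    · rw [Units.val_mul, Matrix.det_mul, hgd, hhd, one_mul]
    · intro u v
      rw [Units.val_mul, ← Matrix.mulVec_mulVec, ← Matrix.mulVec_mulVec]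
      rw [hgf, hhf]
  inv_mem' := by
    rintro g ⟨hgd, hgf⟩
    constructor
    · have : Matrix.det ((g : Matrix.GeneralLinearGroup (Fin m) K) :
          Matrix (Fin m) (Fin m) K) * Matrix.det ((g⁻¹ : Matrix.GeneralLinearGroup (Fin m) K) :
          Matrix (Fin m) (Fin m) K) = 1 := by
        rw [← Matrix.det_mul, ← Units.val_mul, mul_inv_cancel, Units.val_one, Matrix.det_one]
      rw [hgd, one_mul] at this
      exact this
    · intro u v
      have := hgf (Matrix.mulVec ((g⁻¹ : Matrix.GeneralLinearGroup (Fin m) K) :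
        Matrix (Fin m) (Fin m) K) u) (Matrix.mulVec ((g⁻¹ : Matrix.GeneralLinearGroup (Fin m) K) :
        Matrix (Fin m) (Fin m) K) v)
      rw [Matrix.mulVec_mulVec, Matrix.mulVec_mulVec, ← Units.val_mul, mul_inv_cancel,
        Units.val_one, Matrix.one_mulVec, Matrix.one_mulVec] at this
      exact this.symm

section

open Polynomial

/-- Over a finite field, every fixed point of a nontrivial involution is a norm. -/
theorem exists_mul_involution_eq {L : Type*} [Field L] [Finite L] (τ : L →+* L)
    (hτ : ∀ x, τ (τ x) = x) (hne : ∃ x, τ x ≠ x) {a : L} (ha : τ a = a) :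
    ∃ b, b * τ b = a := by
  rcases eq_or_ne a 0 with rfl | ha0
  · exact ⟨0, by simp⟩
  let T : Lˣ →* Lˣ := Units.map τ
  let N : Lˣ →* Lˣ := MonoidHom.id _ * T
  let D : Lˣ →* Lˣ := MonoidHom.id _ / T
  have hNle : N.range ≤ D.ker := by
    rintro _ ⟨x, rfl⟩
    rw [MonoidHom.mem_ker]
    change (x * T x) / T (x * T x) = 1
    rw [div_eq_one]
    ext
    simp [T, hτ, mul_comm]
  have hilbert : N.ker ≤ D.range := by
    intro x hx
    have hx1 : (x : L) * τ x = 1 := by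
      have := congrArg Units.val (MonoidHom.mem_ker.1 hx)
      simpa [N, T] using this
    have key : ∃ c : L, c ≠ 0 ∧ c = x * τ c := by
      obtain ⟨t, ht⟩ := hne
      by_cases h : (1 : L) + x = 0
      · refine ⟨t - τ t, sub_ne_zero.2 ht.symm, ?_⟩
        have : (x : L) = -1 := by linear_combination h
        rw [this, map_sub, hτ]; ring
      · refine ⟨1 + x, h, ?_⟩
        rw [map_add, map_one, mul_add, hx1]; ring
    obtain ⟨c, hc0, hc⟩ := key
    refine ⟨Units.mk0 c hc0, ?_⟩
    change Units.mk0 c hc0 / T (Units.mk0 c hc0) = x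
    rw [div_eq_iff_eq_mul]
    ext
    simpa [T] using hc
  have hcard : Nat.card D.ker ≤ Nat.card N.range := by
    have h1 := Subgroup.card_mul_index N.ker
    have h2 := Subgroup.card_mul_index D.ker
    rw [Subgroup.index_ker] at h1 h2
    have h3 : Nat.card N.ker ≤ Nat.card D.range := Subgroup.card_le_of_le hilbert
    have h4 : 0 < Nat.card D.range := Nat.card_pos
    by_contra hlt
    push Not at hlt
    have : Nat.card N.ker * Nat.card N.range < Nat.card D.ker * Nat.card D.range := by
      calc _ ≤ Nat.card D.range * Nat.card N.range := Nat.mul_le_mul_right _ h3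
        _ < Nat.card D.range * Nat.card D.ker := Nat.mul_lt_mul_of_pos_left hlt h4
        _ = _ := mul_comm _ _
    omega
  have heq := Subgroup.eq_of_le_of_card_ge hNle hcard
  have hmem : Units.mk0 a ha0 ∈ N.range := by
    rw [heq, MonoidHom.mem_ker]
    change Units.mk0 a ha0 / T (Units.mk0 a ha0) = 1
    rw [div_eq_one]
    ext
    simp [T, ha]
  obtain ⟨b, hb⟩ := hmem
  exact ⟨b, by simpa [N, T] using congrArg Units.val hb⟩

section PolynomialNorm

variable {K : Type*} [Field K] (σ : K →+* K)

/-- Modulo an invariant irreducible polynomial every invariant polynomial is a norm. -/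
theorem exists_dvd_mul_map_sub_of_irreducible [Finite K] (hσ : ∀ x, σ (σ x) = x)
    (hne : ∃ x, σ x ≠ x) {π g : K[X]} (hπ : Irreducible π) (hπσ : π.map σ = π)
    (hg : g.map σ = g) : ∃ f : K[X], π ∣ f * f.map σ - g := by
  have : Fact (Irreducible π) := ⟨hπ⟩
  have : Module.Finite K (AdjoinRoot π) := (AdjoinRoot.powerBasis hπ.ne_zero).finite
  have : Finite (AdjoinRoot π) := Module.finite_of_finite K
  let τ : AdjoinRoot π →+* AdjoinRoot π :=
    AdjoinRoot.lift ((AdjoinRoot.of π).comp σ) (AdjoinRoot.root π) (by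
      rw [← eval₂_map, hπσ, AdjoinRoot.eval₂_root])
  have hτ (f : K[X]) : τ (AdjoinRoot.mk π f) = AdjoinRoot.mk π (f.map σ) := by
    rw [AdjoinRoot.lift_mk, ← eval₂_map, ← AdjoinRoot.aeval_eq]
    rfl
  have hmap (f : K[X]) : (f.map σ).map σ = f := by
    rw [Polynomial.map_map]
    ext i
    simp [hσ]
  obtain ⟨b, hb⟩ := exists_mul_involution_eq τ
    (fun x => by
      obtain ⟨f, rfl⟩ := AdjoinRoot.mk_surjective x
      rw [hτ, hτ, hmap])
    (by
      obtain ⟨d, hd⟩ := hne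
      refine ⟨AdjoinRoot.of π d, fun h => hd ?_⟩
      rw [AdjoinRoot.lift_of] at h
      exact (AdjoinRoot.of π).injective h)
    (a := AdjoinRoot.mk π g) (by rw [hτ, hg])
  obtain ⟨f, rfl⟩ := AdjoinRoot.mk_surjective b
  refine ⟨f, AdjoinRoot.mk_eq_mk.1 ?_⟩
  rw [map_mul, ← hτ, hb]

/-- Gluing along coprime invariant moduli. -/
theorem exists_dvd_mul_map_sub_of_isCoprime {μ ν g f₁ f₂ : K[X]} (hμ : μ.map σ = μ)
    (hν : ν.map σ = ν) (h : IsCoprime μ ν) (h₁ : μ ∣ f₁ * f₁.map σ - g)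
    (h₂ : ν ∣ f₂ * f₂.map σ - g) : ∃ f : K[X], μ * ν ∣ f * f.map σ - g := by
  obtain ⟨r, s, hrs⟩ := h
  have hrs' := congrArg (Polynomial.map σ) hrs
  simp only [Polynomial.map_add, Polynomial.map_mul, hμ, hν, Polynomial.map_one] at hrs'
  refine ⟨f₁ * (s * ν) + f₂ * (r * μ), IsCoprime.mul_dvd ⟨r, s, hrs⟩ ?_ ?_⟩
  all_goals simp only [Polynomial.map_add, Polynomial.map_mul, hμ, hν]
  · have e1 : s * ν = 1 - r * μ := by linear_combination hrs
    have e2 : s.map σ * ν = 1 - r.map σ * μ := by linear_combination hrs'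
    rw [e1, e2]
    obtain ⟨w, hw⟩ := h₁
    refine ⟨w + (-f₁ * r * (f₁.map σ * (1 - r.map σ * μ) + f₂.map σ * (r.map σ * μ)))
      + f₂ * r * (f₁.map σ * (1 - r.map σ * μ) + f₂.map σ * (r.map σ * μ))
      + f₁ * (f₂.map σ * r.map σ - f₁.map σ * r.map σ), ?_⟩
    linear_combination hw
  · have e1 : r * μ = 1 - s * ν := by linear_combination hrs
    have e2 : r.map σ * μ = 1 - s.map σ * ν := by linear_combination hrs'
    rw [e1, e2]
    obtain ⟨w, hw⟩ := h₂
    refine ⟨w + (-f₂ * s * (f₂.map σ * (1 - s.map σ * ν) + f₁.map σ * (s.map σ * ν)))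
      + f₁ * s * (f₂.map σ * (1 - s.map σ * ν) + f₁.map σ * (s.map σ * ν))
      + f₂ * (f₁.map σ * s.map σ - f₂.map σ * s.map σ), ?_⟩
    linear_combination hw

/-- Lifting a solution of the norm equation along a nilpotent thickening. -/
theorem exists_dvd_mul_map_sub_of_dvd (hσ : ∀ x, σ (σ x) = x) (hne : ∃ x, σ x ≠ x)
    {μ ν g f : K[X]} (hμ0 : μ ≠ 0) (hμ : μ.map σ = μ) (hν : ν.map σ = ν) (hνμ : ν ∣ μ)
    (hg : g.map σ = g) (hgν : IsCoprime g ν) (h : μ ∣ f * f.map σ - g) :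
    ∃ f : K[X], ν * μ ∣ f * f.map σ - g := by
  have hmap (f : K[X]) : (f.map σ).map σ = f := by
    rw [Polynomial.map_map]
    ext i
    simp [hσ]
  obtain ⟨d, hd⟩ := h
  obtain ⟨e, he⟩ := hνμ
  obtain ⟨ε, hε⟩ : ∃ ε : K, ε + σ ε = 1 := by
    obtain ⟨c, hc⟩ := hne
    by_cases h2 : (2 : K) = 0
    · have hc' : c + σ c ≠ 0 := by
        intro h
        apply hc
        linear_combination h - c * h2
      refine ⟨c / (c + σ c), ?_⟩
      rw [map_div₀, map_add, hσ, add_comm (σ c) c, ← add_div, div_self hc']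
    · refine ⟨2⁻¹, ?_⟩
      rw [map_inv₀, map_ofNat, ← two_mul, mul_inv_cancel₀ h2]
  have hdσ : d.map σ = d := by
    have := congrArg (Polynomial.map σ) hd
    simp only [Polynomial.map_sub, Polynomial.map_mul, hmap, hg, hμ] at this
    apply mul_left_cancel₀ hμ0
    rw [← this, ← hd, mul_comm]
  obtain ⟨r, s, hrs⟩ : IsCoprime (f.map σ) ν := by
    obtain ⟨r, s, hrs⟩ := hgν
    refine ⟨r * f, s - r * e * d, ?_⟩
    linear_combination hrs + r * hd + r * d * he
  have hrs' := congrArg (Polynomial.map σ) hrs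
  simp only [Polynomial.map_add, Polynomial.map_mul, hmap, hν, Polynomial.map_one] at hrs'
  have hC : C ε + C (σ ε) = 1 := by rw [← C_add, hε, C_1]
  refine ⟨f - C ε * d * r * μ, ?_⟩
  simp only [Polynomial.map_sub, Polynomial.map_mul, hdσ, hμ, Polynomial.map_C]
  refine ⟨C ε * d * s + C (σ ε) * d * s.map σ
    + C ε * d * r * C (σ ε) * d * r.map σ * e, ?_⟩
  linear_combination hd - C ε * d * μ * hrs - C (σ ε) * d * μ * hrs' - μ * d * hC
    + C ε * d * r * C (σ ε) * d * r.map σ * μ * he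

/-- Modulo an invariant polynomial every invariant unit is a norm. -/
theorem exists_dvd_mul_map_sub [Finite K] (hσ : ∀ x, σ (σ x) = x) (hne : ∃ x, σ x ≠ x)
    {g : K[X]} (hg : g.map σ = g) (μ : K[X]) (hμ0 : μ ≠ 0) (hμ : μ.map σ = μ)
    (hgμ : IsCoprime g μ) : ∃ f : K[X], μ ∣ f * f.map σ - g := by
  have hmap (f : K[X]) : (f.map σ).map σ = f := by
    rw [Polynomial.map_map]
    ext i
    simp [hσ]
  induction hn : μ.natDegree using Nat.strong_induction_on generalizing μ with
  | _ n ih =>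
  by_cases hu : IsUnit μ
  · exact ⟨0, hu.dvd⟩
  obtain ⟨π, hπm, hπ, hπμ⟩ := Polynomial.exists_monic_irreducible_factor μ hu
  suffices H : ∃ ν : K[X], ν.map σ = ν ∧ ν ∣ μ ∧ 0 < ν.natDegree ∧
      (∃ f : K[X], ν ∣ f * f.map σ - g) ∧ ∀ w : K[X], w.map σ = w → IsCoprime ν w ∨ ν ∣ w by
    obtain ⟨ν, hνσ, ⟨w, rfl⟩, hdeg, ⟨f₀, hf₀⟩, hdich⟩ := H
    have hν0 : ν ≠ 0 := left_ne_zero_of_mul hμ0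
    have hw0 : w ≠ 0 := right_ne_zero_of_mul hμ0
    have hw : w.map σ = w := by
      rw [Polynomial.map_mul, hνσ] at hμ
      exact mul_left_cancel₀ hν0 hμ
    obtain ⟨f, hf⟩ := ih w.natDegree (by rw [← hn, natDegree_mul hν0 hw0]; omega) w hw0 hw
      hgμ.of_mul_right_right rfl
    rcases hdich w hw with h | h
    · exact exists_dvd_mul_map_sub_of_isCoprime σ hνσ hw h hf₀ hf
    · exact exists_dvd_mul_map_sub_of_dvd σ hσ hne hw0 hw hνσ h hg hgμ.of_mul_right_left hf
  have hπσ : Irreducible (π.map σ) := by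
    let e : K ≃+* K := RingEquiv.ofRingHom σ σ (RingHom.ext hσ) (RingHom.ext hσ)
    exact (MulEquiv.irreducible_iff (Polynomial.mapEquiv e)).2 hπ
  by_cases h : π.map σ = π
  · exact ⟨π, h, hπμ, hπ.natDegree_pos,
      exists_dvd_mul_map_sub_of_irreducible σ hσ hne hπ h hg,
      fun w _ => (dvd_or_isCoprime π w hπ).symm⟩
  · have hcop : IsCoprime π (π.map σ) := by
      refine ((dvd_or_isCoprime π _ hπ).symm).resolve_right fun hdvd => h ?_
      exact (eq_of_monic_of_associated hπm (hπm.map σ)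
        (hπ.associated_of_dvd hπσ hdvd)).symm
    have hdvd (w : K[X]) (hw : w.map σ = w) (hπw : π ∣ w) : π * π.map σ ∣ w := by
      refine hcop.mul_dvd hπw ?_
      rw [← hw]
      exact Polynomial.map_dvd σ hπw
    refine ⟨π * π.map σ, by rw [Polynomial.map_mul, hmap, mul_comm], hdvd μ hμ hπμ, ?_, ?_, ?_⟩
    · rw [natDegree_mul hπ.ne_zero hπσ.ne_zero]
      have := hπ.natDegree_pos
      omega
    · obtain ⟨r, s, hrs⟩ := hcop
      have hrs' := congrArg (Polynomial.map σ) hrs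
      simp only [Polynomial.map_add, Polynomial.map_mul, hmap, Polynomial.map_one] at hrs'
      refine ⟨s * π.map σ + g * (r * π), IsCoprime.mul_dvd ⟨r, s, hrs⟩ ?_ ?_⟩
      all_goals simp only [Polynomial.map_add, Polynomial.map_mul, hmap, hg]
      · have e1 : s * π.map σ = 1 - r * π := by linear_combination hrs
        have e2 : r.map σ * π.map σ = 1 - s.map σ * π := by linear_combination hrs'
        rw [e1, e2]
        refine ⟨-r * (s.map σ * π + g * (1 - s.map σ * π)) + g * r *
          (s.map σ * π + g * (1 - s.map σ * π)) + s.map σ - g * s.map σ, ?_⟩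
        ring
      · have e1 : r * π = 1 - s * π.map σ := by linear_combination hrs
        have e2 : s.map σ * π = 1 - r.map σ * π.map σ := by linear_combination hrs'
        rw [e1, e2]
        refine ⟨s * (1 - r.map σ * π.map σ + g * (r.map σ * π.map σ)) - g * s *
          (1 - r.map σ * π.map σ + g * (r.map σ * π.map σ)) - g * r.map σ
          + g * g * r.map σ, ?_⟩
        ring
    · intro w hw
      rcases (dvd_or_isCoprime π w hπ).symm with h' | h'
      · left
        refine IsCoprime.mul_left h' ?_
        have := h'.map (Polynomial.mapRingHom σ)
        simpa [hw] using this
      · exact Or.inr (hdvd w hw h')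

end PolynomialNorm

theorem commute_aeval {K A : Type*} [Field K] [Ring A] [Algebra K A] {c y : A} (h : Commute c y) (f : K[X]) :
    Commute c (aeval y f) := by
  induction f using Polynomial.induction_on' with
  | add f g hf hg => simpa using hf.add_right hg
  | monomial k r =>
    rw [aeval_monomial]
    exact (Algebra.commute_algebraMap_right r c).mul_right (h.pow_right k)

section HermitianMatrix

open Matrix

variable {K n : Type*} [Field K] [StarRing K] [Fintype n] [DecidableEq n]

theorem conjTranspose_aeval (y : Matrix n n K) (f : K[X]) :
    (aeval y f)ᴴ = aeval yᴴ (f.map (starRingEnd K)) := by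
  induction f using Polynomial.induction_on' with
  | add f g hf hg => simp [hf, hg]
  | monomial k c => simp [aeval_monomial, Algebra.algebraMap_eq_smul_one, conjTranspose_pow,
      starRingEnd_apply]

/-- Every invertible Hermitian matrix `y` over a finite field factors as `aᴴ * a` with `a` a
polynomial in `y`. -/
theorem exists_conjTranspose_mul_self_eq [Finite K] (hne : ∃ x : K, star x ≠ x) {y : Matrix n n K}
    (hy : yᴴ = y) (hu : IsUnit y) :
    ∃ a : Matrix n n K, aᴴ * a = y ∧ IsUnit a ∧ ∀ c, Commute c y → Commute c a := by
  obtain ⟨w, rfl⟩ := hu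
  have : Finite (Matrix n n K)ˣ := inferInstance
  obtain ⟨N, hN, hw⟩ := isOfFinOrder_iff_pow_eq_one.1 (isOfFinOrder_of_finite w)
  obtain ⟨f, r, hf⟩ := exists_dvd_mul_map_sub (starRingEnd K) star_star hne (g := X)
    (Polynomial.map_X _) (X ^ N - 1) (X_pow_sub_C_ne_zero hN 1) (by simp)
    ⟨X ^ (N - 1), -1, by rw [← pow_succ, Nat.sub_add_cancel hN]; ring⟩
  have hwN : (w : Matrix n n K) ^ N = 1 := by rw [← Units.val_pow_eq_pow_val, hw, Units.val_one]
  have key := congrArg (aeval (w : Matrix n n K)) hf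
  simp only [map_sub, map_mul, map_pow, aeval_X, map_one, hwN, sub_self, zero_mul] at key
  have hfac : (aeval (w : Matrix n n K) f)ᴴ * aeval (w : Matrix n n K) f = w := by
    rw [conjTranspose_aeval, hy, ← map_mul, mul_comm, map_mul]
    exact sub_eq_zero.1 key
  refine ⟨aeval (w : Matrix n n K) f, hfac, ?_, fun c hc => commute_aeval hc f⟩
  have : IsUnit ((aeval (w : Matrix n n K) f)ᴴ * aeval (w : Matrix n n K) f) := by
    rw [hfac]; exact w.isUnit
  rw [Matrix.isUnit_iff_isUnit_det] at this ⊢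
  rw [det_mul] at this
  exact isUnit_of_mul_isUnit_right this

end HermitianMatrix

section PowerAdjoint

variable {K : Type*} [Field K] [StarRing K]

/-- A sesquilinear form on a `K[X]`-module, nondegenerate on the left, for which `X ^ q` and `X`
are adjoint to each other. -/
structure IsPowerAdjointForm (q : ℕ) {M : Type*} [AddCommGroup M] [Module K[X] M]
    (B : M → M → K) : Prop where
  add_left : ∀ u u' v, B (u + u') v = B u v + B u' v
  add_right : ∀ u v v', B u (v + v') = B u v + B u v'
  smul_left : ∀ (c : K) u v, B ((C c : K[X]) • u) v = c * B u v
  smul_right : ∀ (c : K) u v, B u ((C c : K[X]) • v) = star c * B u v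
  adjoint : ∀ u v, B ((X ^ q : K[X]) • u) v = B u ((X : K[X]) • v)
  nondegenerate : ∀ u, (∀ v, B u v = 0) → u = 0

theorem IsPowerAdjointForm.comp_equiv {q : ℕ} {M N : Type*} [AddCommGroup M] [Module K[X] M]
    [AddCommGroup N] [Module K[X] N] {B : M → M → K} (hB : IsPowerAdjointForm q B)
    (e : N ≃ₗ[K[X]] M) : IsPowerAdjointForm q fun u v => B (e u) (e v) where
  add_left u u' v := by simp [hB.add_left]
  add_right u v v' := by simp [hB.add_right]
  smul_left c u v := by simp [hB.smul_left]
  smul_right c u v := by simp [hB.smul_right]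
  adjoint u v := by simp [hB.adjoint]
  nondegenerate u h := by
    rw [← e.map_eq_zero_iff]
    exact hB.nondegenerate _ fun v => by simpa using h (e.symm v)

theorem IsPowerAdjointForm.sum {q : ℕ} {ι : Type*} [Fintype ι] [DecidableEq ι] {M : ι → Type*}
    [∀ i, AddCommGroup (M i)] [∀ i, Module K[X] (M i)] {B : ∀ i, M i → M i → K}
    (hB : ∀ i, IsPowerAdjointForm q (B i)) :
    IsPowerAdjointForm q fun u v : Π₀ i, M i => ∑ i, B i (u i) (v i) where
  add_left u u' v := by simp [(hB _).add_left, Finset.sum_add_distrib]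
  add_right u v v' := by simp [(hB _).add_right, Finset.sum_add_distrib]
  smul_left c u v := by simp [(hB _).smul_left, Finset.mul_sum]
  smul_right c u v := by simp [(hB _).smul_right, Finset.mul_sum]
  adjoint u v := by simp [(hB _).adjoint]
  nondegenerate u h := by
    ext i
    refine (hB i).nondegenerate _ fun w => ?_
    rw [← h (DFinsupp.single i w), Finset.sum_eq_single i, DFinsupp.single_eq_same]
    · intro j _ hj
      rw [DFinsupp.single_eq_of_ne hj]
      have := (hB j).smul_right 0 (u j) 0
      simpa using this
    · simp

variable [Finite K] {p b q : ℕ} [Fact p.Prime] [CharP K p]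

/-- On a simple module `K[X] ⧸ I` the form `Tr (u * v ^ q)` is a power adjoint form. -/
theorem exists_isPowerAdjointForm_of_isSimpleModule (hq : q = p ^ b)
    (hstar : ∀ x : K, star x = x ^ q) (M : Type*) [AddCommGroup M] [Module K M] [Module K[X] M]
    [IsScalarTower K K[X] M] [Module.Finite K M] [IsSimpleModule K[X] M] :
    ∃ B : M → M → K, IsPowerAdjointForm q B := by
  obtain ⟨I, hI, ⟨e⟩⟩ := isSimpleModule_iff_quot_maximal.1 (inferInstance : IsSimpleModule K[X] M)
  let _ : Field (K[X] ⧸ I) := Ideal.Quotient.field I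
  have : Module.Finite K (K[X] ⧸ I) := Module.Finite.equiv (e.restrictScalars K)
  have : CharP (K[X] ⧸ I) p := charP_of_injective_algebraMap (algebraMap K (K[X] ⧸ I)).injective p
  have hsmul (f : K[X]) (x : K[X] ⧸ I) : f • x = Ideal.Quotient.mk I f * x := Algebra.smul_def _ _
  have hC (c : K) (x : K[X] ⧸ I) : (C c : K[X]) • x = c • x := by
    rw [← Polynomial.algebraMap_eq, algebraMap_smul]
  suffices IsPowerAdjointForm q
      fun u v : K[X] ⧸ I => Algebra.trace K (K[X] ⧸ I) (u * v ^ q) from ⟨_, this.comp_equiv e⟩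
  refine ⟨fun u u' v => ?_, fun u v v' => ?_, fun c u v => ?_, fun c u v => ?_, fun u v => ?_,
    fun u h => ?_⟩
  · rw [add_mul, map_add]
  · rw [hq, add_pow_char_pow, mul_add, map_add]
  · rw [hC, smul_mul_assoc, map_smul, smul_eq_mul]
  · rw [hC, _root_.smul_pow, mul_smul_comm, map_smul, smul_eq_mul, hstar]
  · rw [hsmul, hsmul, map_pow]
    congr 1
    ring
  · refine (traceForm_nondegenerate K (K[X] ⧸ I)).1 u fun w => ?_
    have : Finite (K[X] ⧸ I) := Module.finite_of_finite K
    obtain ⟨v, rfl⟩ : ∃ v, v ^ q = w := by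
      have hinj : Function.Injective (iterateFrobenius (K[X] ⧸ I) p b) :=
        (iterateFrobenius (K[X] ⧸ I) p b).injective
      obtain ⟨v, hv⟩ := (Finite.injective_iff_surjective.1 hinj) w
      exact ⟨v, by rw [hq, ← hv, iterateFrobenius_def]⟩
    exact h v

theorem exists_isPowerAdjointForm (hq : q = p ^ b) (hstar : ∀ x : K, star x = x ^ q)
    (M : Type*) [AddCommGroup M] [Module K M] [Module K[X] M] [IsScalarTower K K[X] M]
    [Module.Finite K M] [IsSemisimpleModule K[X] M] :
    ∃ B : M → M → K, IsPowerAdjointForm q B := by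
  have : Module.Finite K[X] M := Module.Finite.of_restrictScalars_finite K K[X] M
  obtain ⟨k, S, e, hS⟩ := IsSemisimpleModule.exists_linearEquiv_fin_dfinsupp K[X] M
  have : Finite M := Module.finite_of_finite K
  have (i : Fin k) : Module.Finite K (S i) := Module.Finite.of_finite
  have (i : Fin k) : ∃ B : S i → S i → K, IsPowerAdjointForm q B :=
    exists_isPowerAdjointForm_of_isSimpleModule hq hstar (S i)
  choose B hB using this
  exact ⟨_, (IsPowerAdjointForm.sum hB).comp_equiv e⟩

end PowerAdjoint

section UnitaryConjugacy

open Matrix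

variable {K n : Type*} [Field K] [Finite K] [StarRing K] [Fintype n] [DecidableEq n]
  {p b q : ℕ} [Fact p.Prime] [CharP K p]

/-- For a semisimple matrix `g`, the power `g ^ q` is similar to `gᴴ`. -/
theorem exists_isUnit_mul_pow_eq (hq : q = p ^ b) (hstar : ∀ x : K, star x = x ^ q)
    {g : Matrix n n K} (hg : Module.End.IsSemisimple (toLin' g)) :
    ∃ x : Matrix n n K, IsUnit x ∧ x * g ^ q = gᴴ * x := by
  have : IsSemisimpleModule K[X] (Module.AEval' (toLin' g)) := hg
  obtain ⟨B, hB⟩ := exists_isPowerAdjointForm hq hstar (Module.AEval' (toLin' g))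
  let o : (n → K) ≃ₗ[K] Module.AEval' (toLin' g) := Module.AEval'.of (toLin' g)
  have ho (c : K) (u : n → K) : o (c • u) = (C c : K[X]) • o u := by
    rw [map_smul, Module.AEval.C_smul]
  have hX (k : ℕ) (u : n → K) : (X ^ k : K[X]) • o u = o ((g ^ k) *ᵥ u) := by
    rw [← toLin'_apply, toLin'_pow]
    exact Module.AEval.X_pow_smul_of _ _ _
  let x : Matrix n n K := Matrix.of fun j i => B (o (Pi.single i 1)) (o (Pi.single j 1))
  have hx (u : n → K) (v : n → K) : B (o u) (o v) = star v ⬝ᵥ x *ᵥ u := by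
    let l (v : n → K) : (n → K) →+ K := AddMonoidHom.mk' (fun u => B (o u) (o v)) fun u u' => by
      rw [map_add, hB.add_left]
    let r (u : n → K) : (n → K) →+ K := AddMonoidHom.mk' (fun v => B (o u) (o v)) fun v v' => by
      rw [map_add, hB.add_right]
    have hl (u v : n → K) : B (o u) (o v) = ∑ i, u i * B (o (Pi.single i 1)) (o v) := by
      calc B (o u) (o v) = l v (∑ i, u i • Pi.single i (1 : K)) := by rw [← pi_eq_sum_univ' u]; rfl
        _ = _ := by
          rw [map_sum]
          refine Finset.sum_congr rfl fun i _ => ?_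
          rw [← hB.smul_left, ← ho]; rfl
    have hr (u v : n → K) : B (o u) (o v) = ∑ j, star (v j) * B (o u) (o (Pi.single j 1)) := by
      calc B (o u) (o v) = r u (∑ i, v i • Pi.single i (1 : K)) := by rw [← pi_eq_sum_univ' v]; rfl
        _ = _ := by
          rw [map_sum]
          refine Finset.sum_congr rfl fun i _ => ?_
          rw [← hB.smul_right, ← ho]; rfl
    rw [hr]
    refine Finset.sum_congr rfl fun j _ => ?_
    rw [hl, mulVec, dotProduct]
    simp only [x, Matrix.of_apply, Pi.star_apply, mul_comm]
  refine ⟨x, ?_, ?_⟩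
  · rw [← mulVec_injective_iff_isUnit]
    refine (injective_iff_map_eq_zero (mulVecLin x)).2 fun u hu => ?_
    refine o.map_eq_zero_iff.1 (hB.nondegenerate _ fun v => ?_)
    obtain ⟨v, rfl⟩ := o.surjective v
    rw [hx, ← mulVecLin_apply, hu, dotProduct_zero]
  · refine ext_of_mulVec_single fun i => ?_
    refine dotProduct_eq _ _ fun w => ?_
    obtain ⟨v, rfl⟩ : ∃ v : n → K, star v = w := ⟨star w, star_star w⟩
    have := hB.adjoint (o (Pi.single i 1)) (o v)
    have hX1 := hX 1 v
    rw [pow_one, pow_one] at hX1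
    rw [hX, hX1, hx, hx, star_mulVec, ← dotProduct_mulVec] at this
    rw [dotProduct_comm, dotProduct_comm _ (star v), ← mulVec_mulVec, ← mulVec_mulVec]
    exact this

/-- For a semisimple unitary matrix `g`, the power `g ^ q` is conjugate to `gᴴ` by a unitary
matrix. -/
theorem exists_unitary_mul_pow_eq (hq : q = p ^ b) (hstar : ∀ x : K, star x = x ^ q)
    (hne : ∃ x : K, star x ≠ x) {g : Matrix n n K} (hu : gᴴ * g = 1)
    (hg : Module.End.IsSemisimple (toLin' g)) :
    ∃ z : Matrix n n K, zᴴ * z = 1 ∧ z * g ^ q = gᴴ * z := by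
  obtain ⟨x, hxu, hx⟩ := exists_isUnit_mul_pow_eq hq hstar hg
  have hu' : g * gᴴ = 1 := mul_eq_one_comm.1 hu
  have huq : (gᴴ) ^ q * g ^ q = 1 := by
    rw [← (show Commute gᴴ g from hu.trans hu'.symm).mul_pow, hu, one_pow]
  have huq' : g ^ q * (gᴴ) ^ q = 1 := mul_eq_one_comm.1 huq
  have hxH : (gᴴ) ^ q * xᴴ = xᴴ * g := by simpa using congrArg conjTranspose hx
  have hy : Commute (g ^ q) (xᴴ * x) := by
    calc g ^ q * (xᴴ * x) = g ^ q * (xᴴ * (g * gᴴ) * x) := by rw [hu', mul_one]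
      _ = g ^ q * ((xᴴ * g) * (gᴴ * x)) := by simp only [mul_assoc]
      _ = (g ^ q * (gᴴ) ^ q) * (xᴴ * x) * g ^ q := by rw [← hx, ← hxH]; simp only [mul_assoc]
      _ = _ := by rw [huq', one_mul]
  have hxHu : IsUnit xᴴ := hxu.star
  obtain ⟨a, ha, hau, hac⟩ := exists_conjTranspose_mul_self_eq hne (y := xᴴ * x) (by simp)
    (hxHu.mul hxu)
  obtain ⟨a, rfl⟩ := hau
  have hcomm : Commute (g ^ q) (↑a⁻¹ : Matrix n n K) := (hac _ hy).units_inv_right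
  refine ⟨x * (↑a⁻¹ : Matrix n n K), ?_, ?_⟩
  · have h1 : ((↑a⁻¹ : Matrix n n K))ᴴ * (a : Matrix n n K)ᴴ = 1 := by
      rw [← conjTranspose_mul, Units.mul_inv, conjTranspose_one]
    rw [conjTranspose_mul, mul_assoc, ← mul_assoc xᴴ, ← ha, mul_assoc, Units.mul_inv, mul_one, h1]
  · rw [mul_assoc, ← hcomm.eq, ← mul_assoc, hx, mul_assoc]

end UnitaryConjugacy

theorem commute_projection {K V : Type*} [Field K] [AddCommGroup V] [Module K V] {f : Module.End K V}
    {S T : Submodule K V} (h : IsCompl S T) (hS : S ∈ f.invtSubmodule) (hT : T ∈ f.invtSubmodule) :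
    Commute f (S.projection T h) := by
  refine LinearMap.ext fun v => ?_
  simp only [Module.End.mul_apply]
  have h1 : f v = f (S.projection T h v) + f (v - S.projection T h v) := by
    rw [← map_add, add_sub_cancel]
  rw [h1, map_add, Submodule.projection_apply_of_mem_left h (hS (Submodule.projection_apply_mem h v)),
    (Submodule.projection_apply_eq_zero_iff h).2 (hT (Submodule.sub_projection_mem h v)), add_zero]

section HermitianPerp

open Matrix

variable {K n : Type*} [Field K] [StarRing K] [Fintype n]

theorem dotProduct_star_comm (u v : n → K) : v ⬝ᵥ star u = star (u ⬝ᵥ star v) := by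
  simp [dotProduct, star_sum, mul_comm]

theorem mulVec_dotProduct_star (A : Matrix n n K) (u v : n → K) :
    (A *ᵥ u) ⬝ᵥ star v = u ⬝ᵥ star (Aᴴ *ᵥ v) := by
  rw [star_mulVec, conjTranspose_conjTranspose, dotProduct_comm (A *ᵥ u), dotProduct_mulVec,
    dotProduct_comm]

theorem eq_of_forall_dotProduct_star {A B : Matrix n n K}
    (h : ∀ u v, (A *ᵥ u) ⬝ᵥ star v = (B *ᵥ u) ⬝ᵥ star v) : A = B := by
  classical
  refine ext_of_mulVec_single fun i => dotProduct_eq _ _ fun w => ?_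
  simpa using h (Pi.single i 1) (star w)

/-- The orthogonal complement for the standard Hermitian form. -/
def hermPerp (S : Submodule K (n → K)) : Submodule K (n → K) where
  carrier := {v | ∀ s ∈ S, s ⬝ᵥ star v = 0}
  zero_mem' := by simp
  add_mem' hv hw s hs := by rw [star_add, dotProduct_add, hv s hs, hw s hs, add_zero]
  smul_mem' c v hv s hs := by rw [star_smul, dotProduct_smul, hv s hs, smul_zero]

theorem mem_hermPerp {S : Submodule K (n → K)} {v : n → K} :
    v ∈ hermPerp S ↔ ∀ s ∈ S, s ⬝ᵥ star v = 0 := Iff.rfl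

theorem mem_hermPerp' {S : Submodule K (n → K)} {v : n → K} :
    v ∈ hermPerp S ↔ ∀ s ∈ S, v ⬝ᵥ star s = 0 :=
  forall₂_congr fun s _ => by rw [dotProduct_star_comm v s, star_eq_zero]

theorem finrank_add_finrank_hermPerp [Finite K] [DecidableEq n] (S : Submodule K (n → K)) :
    Module.finrank K S + Module.finrank K (hermPerp S) = Fintype.card n := by
  let T : Submodule K (n → K) := S.dualAnnihilator.comap (dotProductEquiv K n).toLinearMap
  have hT : Module.finrank K T = Module.finrank K S.dualAnnihilator :=
    (LinearEquiv.ofSubmodule' (dotProductEquiv K n) S.dualAnnihilator).finrank_eq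
  have e : hermPerp S ≃ T :=
    { toFun v := ⟨star v.1, by
        refine (Submodule.mem_dualAnnihilator _).2 fun s hs => ?_
        simpa [dotProduct_comm] using v.2 s hs⟩
      invFun v := ⟨star v.1, fun s hs => by
        have := (Submodule.mem_dualAnnihilator _).1 v.2 s hs
        simpa [dotProduct_comm] using this⟩
      left_inv v := by simp
      right_inv v := by simp }
  have hcard := Nat.card_congr e
  rw [Module.natCard_eq_pow_finrank (K := K), Module.natCard_eq_pow_finrank (K := K) (V := T)]
    at hcard
  rw [Nat.pow_right_injective Finite.one_lt_card hcard, hT,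
    Subspace.finrank_add_finrank_dualAnnihilator_eq, Module.finrank_fintype_fun_eq_card]

theorem isCompl_hermPerp [Finite K] [DecidableEq n] {S T : Submodule K (n → K)}
    (hST : Module.finrank K S = Module.finrank K T) (h : Disjoint S (hermPerp T)) :
    IsCompl S (hermPerp T) := by
  refine ⟨h, codisjoint_iff.2 (Submodule.eq_top_of_disjoint _ _ ?_ h)⟩
  rw [hST, finrank_add_finrank_hermPerp, Module.finrank_fintype_fun_eq_card]

theorem conjTranspose_toMatrix'_projection [DecidableEq n] {S T : Submodule K (n → K)}
    (h : IsCompl S (hermPerp T)) (h' : IsCompl T (hermPerp S)) :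
    (LinearMap.toMatrix' (S.projection _ h))ᴴ = LinearMap.toMatrix' (T.projection _ h') := by
  refine eq_of_forall_dotProduct_star fun u v => ?_
  rw [mulVec_dotProduct_star, conjTranspose_conjTranspose, LinearMap.toMatrix'_mulVec,
    LinearMap.toMatrix'_mulVec]
  have hv := mem_hermPerp.1 (Submodule.sub_projection_mem h v) _
    (Submodule.projection_apply_mem h' u)
  have hu := mem_hermPerp'.1 (Submodule.sub_projection_mem h' u) _
    (Submodule.projection_apply_mem h v)
  rw [star_sub, dotProduct_sub, sub_eq_zero] at hv
  rw [sub_dotProduct, sub_eq_zero] at hu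
  rw [hu, hv]

theorem hermPerp_mem_invtSubmodule [DecidableEq n] {g : Matrix n n K} {k : ℕ} (hg : gᴴ = g ^ k)
    {S : Submodule K (n → K)} (hS : S ∈ Module.End.invtSubmodule (toLin' g)) :
    hermPerp S ∈ Module.End.invtSubmodule (toLin' g) := by
  intro v hv s hs
  rw [toLin'_apply, ← conjTranspose_conjTranspose g, ← mulVec_dotProduct_star, hg]
  refine hv _ ?_
  rw [← toLin'_apply, toLin'_pow]
  exact Module.End.pow_apply_mem_of_forall_mem k hS s hs

/-- For `g` semisimple with `gᴴ` a power of `g`, there are a simple `g`-invariant subspace `S` and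
an invariant subspace `T` paired perfectly with it, which are either equal or both isotropic. -/
theorem exists_invtSubmodule_pair [Finite K] [DecidableEq n] [Nonempty n] {g : Matrix n n K} {k : ℕ}
    (hg : gᴴ = g ^ k) (hs : Module.End.IsSemisimple (toLin' g)) :
    ∃ S ∈ Module.End.invtSubmodule (toLin' g), ∃ T ∈ Module.End.invtSubmodule (toLin' g),
      S ≠ ⊥ ∧ (∀ P ∈ Module.End.invtSubmodule (toLin' g), P ≤ S → P = ⊥ ∨ P = S) ∧
      IsCompl S (hermPerp T) ∧ IsCompl T (hermPerp S) ∧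
      (S = T ∨ (S ≤ hermPerp S ∧ T ≤ hermPerp T)) := by
  let I := Module.End.invtSubmodule (toLin' g)
  have hex : ∃ d, ∃ S ∈ I, S ≠ ⊥ ∧ Module.finrank K S = d :=
    ⟨_, ⊤, Module.End.invtSubmodule.top_mem _, top_ne_bot, rfl⟩
  classical
  have hfind := Nat.find_spec hex
  have hmin : ∀ P ∈ I, P ≠ ⊥ → Nat.find hex ≤ Module.finrank K P := fun P hP h0 =>
    Nat.find_min' hex ⟨P, hP, h0, rfl⟩
  generalize Nat.find hex = d at hfind hmin
  have hsimple : ∀ S : Submodule K (n → K), Module.finrank K S = d → ∀ P ∈ I, P ≤ S → P = ⊥ ∨ P = S :=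
    fun S hS P hP hle => or_iff_not_imp_left.2 fun h0 =>
      Submodule.eq_of_le_of_finrank_le hle (hS.trans_le (hmin P hP h0))
  by_cases hiso : ∃ S ∈ I, Module.finrank K S = d ∧ S ≠ ⊥ ∧ ¬ S ≤ hermPerp S
  · obtain ⟨S, hS, hd, h0, hSS⟩ := hiso
    have hdisj : Disjoint S (hermPerp S) := by
      rw [disjoint_iff]
      refine (hsimple S hd _ (Module.End.invtSubmodule.inf_mem hS
        (hermPerp_mem_invtSubmodule hg hS)) inf_le_left).resolve_right fun h => hSS ?_
      exact inf_eq_left.1 h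
    exact ⟨S, hS, S, hS, h0, hsimple S hd, isCompl_hermPerp rfl hdisj, isCompl_hermPerp rfl hdisj,
      Or.inl rfl⟩
  · push Not at hiso
    obtain ⟨S, hS, h0, hd⟩ := hfind
    obtain ⟨T, hT, hc⟩ := Module.End.isSemisimple_iff.1 hs _ (hermPerp_mem_invtSubmodule hg hS)
    have hrank : Module.finrank K S = Module.finrank K T := by
      have h1 := finrank_add_finrank_hermPerp S
      have h2 := Submodule.finrank_add_eq_of_isCompl hc
      rw [Module.finrank_fintype_fun_eq_card] at h2
      omega
    have hST : Disjoint S (hermPerp T) := by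
      refine Submodule.disjoint_def.2 fun s hs hsT => ?_
      refine dotProduct_eq_zero _ fun w => ?_
      obtain ⟨v, hv, t, ht, hvt⟩ := Submodule.mem_sup.1
        ((codisjoint_iff.1 hc.codisjoint).symm ▸ Submodule.mem_top : star w ∈ hermPerp S ⊔ T)
      have : s ⬝ᵥ star (star w) = 0 := by
        rw [← hvt, star_add, dotProduct_add, hv s hs, mem_hermPerp'.1 hsT t ht, add_zero]
      rwa [star_star] at this
    have hT0 : T ≠ ⊥ := by
      rintro rfl
      rw [finrank_bot, Submodule.finrank_eq_zero] at hrank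
      exact h0 hrank
    exact ⟨S, hS, T, hT, h0, hsimple S hd, isCompl_hermPerp hrank hST, hc.symm,
      Or.inr ⟨hiso S hS hd h0, hiso T hT (hrank ▸ hd) hT0⟩⟩

end HermitianPerp

section DetAdjust

open Matrix

/-- If `f` acts irreducibly on a finite vector space then every scalar is the determinant of a
polynomial in `f`. -/
theorem exists_det_aeval_eq {K V : Type*} [Field K] [Finite K] [AddCommGroup V] [Module K V]
    [Module.Finite K V] [Nontrivial V] {f : Module.End K V}
    (hf : ∀ P ∈ f.invtSubmodule, P = ⊥ ∨ P = ⊤) (t : K) :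
    ∃ φ : K[X], LinearMap.det (aeval f φ) = t := by
  let M := Module.AEval' f
  have hsimple : IsSimpleModule K[X] M := by
    rw [isSimpleModule_iff, ← (Module.AEval.mapSubmodule K V f).isSimpleOrder_iff]
    have : Nontrivial (Algebra.lsmul K K V f).invtSubmodule :=
      ⟨⟨⊥, Module.End.invtSubmodule.bot_mem _⟩, ⟨⊤, Module.End.invtSubmodule.top_mem _⟩,
        fun h => bot_ne_top (congrArg Subtype.val h)⟩
    exact ⟨fun P => (hf P.1 P.2).imp Subtype.ext Subtype.ext⟩
  obtain ⟨I, hI, ⟨e⟩⟩ := isSimpleModule_iff_quot_maximal.1 hsimple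
  let _ : Field (K[X] ⧸ I) := Ideal.Quotient.field I
  let e' : V ≃ₗ[K] K[X] ⧸ I := (Module.AEval'.of f).trans (e.restrictScalars K)
  have : Module.Finite K (K[X] ⧸ I) := Module.Finite.equiv e'
  have : Finite (K[X] ⧸ I) := Module.finite_of_finite K
  obtain ⟨x, hx⟩ := FiniteField.norm_surjective K (K[X] ⧸ I) t
  obtain ⟨φ, rfl⟩ := Ideal.Quotient.mk_surjective x
  refine ⟨φ, ?_⟩
  rw [← hx, Algebra.norm_apply, ← LinearMap.det_conj _ e']
  congr 1
  refine LinearMap.ext fun y => ?_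
  obtain ⟨v, rfl⟩ := e'.surjective y
  simp only [LinearMap.comp_apply, LinearEquiv.coe_coe, LinearEquiv.symm_apply_apply]
  change e (Module.AEval'.of f (aeval f φ v)) = _
  have := Module.AEval.of_aeval_smul (R := K) (M := V) f φ v
  rw [show Module.AEval'.of f (aeval f φ v) = φ • Module.AEval'.of f v from this, map_smul]
  rfl

/-- If `g` acts irreducibly on `S` then every scalar is the determinant of an endomorphism which is
a polynomial in `g` on `S` and trivial on a complement. -/
theorem exists_det_aeval_mul_projection_eq {K V : Type*} [Field K] [Finite K] [AddCommGroup V]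
    [Module K V] [Module.Finite K V] {f : Module.End K V} {S T : Submodule K V} (h : IsCompl S T)
    (hS : S ∈ f.invtSubmodule) (h0 : S ≠ ⊥)
    (hf : ∀ P ∈ f.invtSubmodule, P ≤ S → P = ⊥ ∨ P = S) (t : K) :
    ∃ φ : K[X], LinearMap.det (aeval f φ * S.projection T h + 1 - S.projection T h) = t := by
  have : Nontrivial S := Submodule.nontrivial_iff_ne_bot.2 h0
  obtain ⟨φ, hφ⟩ := exists_det_aeval_eq (f := f.restrict hS) (fun P hP => by
    have hmem : P.map S.subtype ∈ f.invtSubmodule := by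
      rintro _ ⟨v, hv, rfl⟩
      exact ⟨_, hP hv, rfl⟩
    refine (hf _ hmem (Submodule.map_subtype_le S P)).imp (fun h => ?_) fun h => ?_
    · exact Submodule.map_injective_of_injective S.subtype_injective (h.trans (Submodule.map_bot _).symm)
    · refine Submodule.map_injective_of_injective S.subtype_injective ?_
      rw [h, Submodule.map_subtype_top]) t
  refine ⟨φ, ?_⟩
  set E := S.projection T h with hE
  have hr : ∀ s : S, aeval f φ (s : V) = (aeval (f.restrict hS) φ s : S) := fun s => by
    clear hφ
    induction φ using Polynomial.induction_on' with
    | add a b ha hb => simp [ha, hb]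
    | monomial k c =>
      have := congrArg (fun l : Module.End K S => ((l s : S) : V)) (Module.End.pow_restrict k hS)
      simpa [aeval_monomial, Module.algebraMap_end_apply] using congrArg (c • ·) this.symm
  have hSE : ∀ s ∈ S, (aeval f φ * E + 1 - E) s = aeval f φ s := fun s hs => by
    simp [hE, Submodule.projection_apply_of_mem_left h hs]
  have he : S ≤ S.comap (aeval f φ * E + 1 - E) := fun s hs => by
    rw [Submodule.mem_comap, hSE s hs, hr ⟨s, hs⟩]
    exact Subtype.prop _
  rw [LinearMap.det_eq_det_mul_det S _ he, ← hφ]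
  convert mul_one _ using 2
  · convert LinearMap.det_id
    refine LinearMap.ext fun y => ?_
    obtain ⟨v, rfl⟩ := S.mkQ_surjective y
    rw [Submodule.mkQ_apply, Submodule.mapQ_apply, LinearMap.id_apply, Submodule.Quotient.eq]
    have : (aeval f φ * E + 1 - E) v - v = aeval f φ (E v) - E v := by simp; abel
    rw [this]
    have hv : E v ∈ S := Submodule.projection_apply_mem h v
    exact sub_mem (by rw [hr ⟨_, hv⟩]; exact Subtype.prop _) hv
  · refine LinearMap.ext fun s => Subtype.ext ?_
    rw [← hr s, LinearMap.coe_restrict_apply, hSE s s.2]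

variable {K n : Type*} [Field K] [Finite K] [StarRing K] [Fintype n] [DecidableEq n] [Nonempty n]

theorem exists_ne_zero_eq_mul_star {K : Type*} [Field K] [StarRing K]
    (hne : ∃ x : K, star x ≠ x) {u : K} (hu : star u * u = 1) :
    ∃ t : K, t ≠ 0 ∧ t = u * star t := by
  by_contra! h
  have key (w : K) : w + u * star w = 0 := by
    by_contra h0
    refine h _ h0 ?_
    rw [star_add, star_mul', star_star]
    linear_combination (-w) * hu
  obtain ⟨x, hx⟩ := hne
  have h1 := key 1
  rw [star_one] at h1
  exact hx (by linear_combination star x * h1 - key x)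

/-- The centralizer, in the unitary group, of a semisimple unitary matrix contains elements of
every norm-one determinant. -/
theorem exists_unitary_commute_det_eq (hne : ∃ x : K, star x ≠ x) {g : Matrix n n K}
    (hu : gᴴ * g = 1) (hs : Module.End.IsSemisimple (toLin' g)) {u : K} (hu1 : star u * u = 1) :
    ∃ c : Matrix n n K, cᴴ * c = 1 ∧ Commute c g ∧ c.det = u := by
  obtain ⟨t, ht0, ht⟩ := exists_ne_zero_eq_mul_star hne hu1
  obtain ⟨k, hk⟩ : ∃ k, gᴴ = g ^ k := by
    let w : (Matrix n n K)ˣ := ⟨g, gᴴ, mul_eq_one_comm.1 hu, hu⟩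
    have := (mem_powers_iff_mem_zpowers (x := w) (y := w⁻¹)).2 (inv_mem (Subgroup.mem_zpowers w))
    obtain ⟨k, hk⟩ := this
    exact ⟨k, by simpa [w] using (congrArg Units.val hk).symm⟩
  obtain ⟨S, hS, T, hT, h0, hmin, h, h', hiso⟩ := exists_invtSubmodule_pair hk hs
  have hSp := hermPerp_mem_invtSubmodule hk hS
  have hTp := hermPerp_mem_invtSubmodule hk hT
  obtain ⟨φ, hφ⟩ := exists_det_aeval_mul_projection_eq h hS h0 hmin t
  have hEH := conjTranspose_toMatrix'_projection h h'
  have hgE := commute_projection h hS hTp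
  set F := S.projection _ h with hF
  set F' := T.projection _ h' with hF'
  have hFF' : Commute F F' := by
    rcases hiso with rfl | ⟨h1, h2⟩
    · exact Commute.refl _
    · have hz : F * F' = 0 := LinearMap.ext fun v =>
        (Submodule.projection_apply_eq_zero_iff h).2 (h2 (Submodule.projection_apply_mem h' v))
      have hz' : F' * F = 0 := LinearMap.ext fun v =>
        (Submodule.projection_apply_eq_zero_iff h').2 (h1 (Submodule.projection_apply_mem h v))
      exact hz.trans hz'.symm
  set E := LinearMap.toMatrix' F with hE
  have hEE : Commute E Eᴴ := by
    rw [hEH]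
    exact hFF'.map (toLinAlgEquiv' (R := K) (n := n)).symm
  have hgE' : Commute g E := by
    have := hgE.map (toLinAlgEquiv' (R := K) (n := n)).symm
    rwa [show (toLinAlgEquiv' (R := K) (n := n)).symm (toLin' g) = g from
      LinearMap.toMatrix'_toLin' g] at this
  set P := aeval g φ with hP
  have hPP : Commute P Pᴴ := by
    rw [hP, conjTranspose_aeval, hk]
    exact commute_aeval ((commute_aeval (Commute.refl g) φ).symm.pow_right k) _
  have hEP : Commute E P := commute_aeval hgE'.symm φ
  have hEPH : Commute E Pᴴ := by
    rw [hP, conjTranspose_aeval, hk]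
    exact commute_aeval (hgE'.symm.pow_right k) _
  have hEHP : Commute Eᴴ P := by
    simpa [Commute, SemiconjBy] using congrArg conjTranspose hEPH.eq.symm
  set a := P * E + 1 - E with ha
  have haH : aᴴ = Eᴴ * Pᴴ + 1 - Eᴴ := by simp [ha]
  have hga : Commute g a :=
    (((commute_aeval (Commute.refl g) φ).mul_right hgE').add_right (Commute.one_right g)).sub_right
      hgE'
  have hgaH : Commute g aᴴ := by
    have : Commute gᴴ a := by rw [hk]; exact hga.pow_left k
    simpa [Commute, SemiconjBy] using congrArg conjTranspose this.eq.symm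
  have haa : Commute a aᴴ := by
    have h1 : Commute E aᴴ := by
      rw [haH]; exact ((hEE.mul_right hEPH).add_right (Commute.one_right E)).sub_right hEE
    have h2 : Commute P aᴴ := by
      rw [haH]; exact ((hEHP.symm.mul_right hPP).add_right (Commute.one_right P)).sub_right hEHP.symm
    exact ((h2.mul_left h1).add_left (Commute.one_left _)).sub_left h1
  have hdet : a.det = t := by
    rw [← hφ, ← LinearMap.det_toLin']
    congr 1
    have h1 : toLin' P = aeval (toLin' g) φ :=
      (aeval_algHom_apply (toLinAlgEquiv' (R := K) (n := n)) g φ).symm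
    rw [ha, map_sub, map_add, toLin'_mul, h1, hE, toLin'_toMatrix', toLin'_one]
    rfl
  have hau : IsUnit a.det := by rw [hdet]; exact ht0.isUnit
  have haHu : IsUnit aᴴ.det := by rw [det_conjTranspose]; exact hau.star
  refine ⟨a * (aᴴ)⁻¹, ?_, ?_, ?_⟩
  · rw [conjTranspose_mul, conjTranspose_nonsing_inv, conjTranspose_conjTranspose, mul_assoc,
      ← mul_assoc aᴴ, ← haa.eq, mul_assoc a, mul_nonsing_inv _ haHu, mul_one, nonsing_inv_mul _ hau]
  · refine (hga.mul_right ?_).symm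
    obtain ⟨v, hv⟩ := (Matrix.isUnit_iff_isUnit_det _).2 haHu
    rw [← hv, ← coe_units_inv]
    rw [← hv] at hgaH
    exact hgaH.units_inv_right
  · have hst : star t ≠ 0 := star_ne_zero.2 ht0
    rw [det_mul, det_nonsing_inv, det_conjTranspose, hdet, Ring.inverse_eq_inv', ← div_eq_mul_inv,
      div_eq_iff hst]
    exact ht

end DetAdjust

section Intertwiner

variable {K R V W : Type*} [Field K] [Finite K] [Ring R] [Algebra K R]
  [AddCommGroup V] [Module K V] [Module R V] [IsScalarTower K R V] [Module.Finite K V]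
  [AddCommGroup W] [Module K W] [Module R W] [IsScalarTower K R W] [Module.Finite K W]

/-- On a simple module over a finite field, if `a` does not act as zero then some multiple of `a`
has nonzero trace. -/
theorem exists_trace_lsmul_mul_ne_zero [IsSimpleModule R V] {a : R} {w : V} (ha : a • w ≠ 0) :
    ∃ c : R, LinearMap.trace K V (Algebra.lsmul K K V (c * a)) ≠ 0 := by
  classical
  have : Finite V := Module.finite_of_finite K
  let F := Module.End R V
  have : Finite F := DFunLike.finite _
  let _ : Field F := littleWedderburn F
  have : Module.Finite K F := Module.Finite.of_finite
  have : IsScalarTower K F V := ⟨fun k f v => rfl⟩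
  obtain ⟨d, hd⟩ := Algebra.trace_surjective K F 1
  obtain ⟨l, hl⟩ : ∃ l : V →ₗ[F] F, l (a • w) = 1 := by
    obtain ⟨l, hl⟩ := not_forall.1 (mt (Module.forall_dual_apply_eq_zero_iff F (a • w)).1 ha)
    exact ⟨(l (a • w))⁻¹ • l, inv_mul_cancel₀ hl⟩
  have : Fintype V := Fintype.ofFinite V
  obtain ⟨c, hc⟩ := jacobson_density (R := R) ((LinearMap.toSpanSingleton F V (d • w)).comp l)
    Finset.univ
  refine ⟨c, ?_⟩
  let l' : V →ₗ[K] F :=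
    (l.restrictScalars K).comp (Algebra.lsmul K K V a)
  have key : Algebra.lsmul K K V (c * a) =
      ((LinearMap.toSpanSingleton F V (d • w)).restrictScalars K).comp l' := by
    refine LinearMap.ext fun v => ?_
    have := hc (a • v) (Finset.mem_univ _)
    exact (mul_smul c a v).trans this.symm
  rw [key, LinearMap.trace_comp_comm']
  have h2 : l'.comp ((LinearMap.toSpanSingleton F V (d • w)).restrictScalars K) =
      Algebra.lmul K F d := by
    refine LinearMap.ext fun x => ?_
    change l (a • (x • d • w)) = d * x
    have : a • (x • d • w) = (x * d) • (a • w) := by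
      rw [smul_smul]
      exact (map_smul (x * d : Module.End R V) a w).symm
    rw [this, map_smul, hl, smul_eq_mul, mul_one, mul_comm]
  rw [h2]
  exact ne_of_eq_of_ne hd one_ne_zero

/-- Two simple modules over a finite field with the same traces are related by a nonzero map. -/
theorem exists_linearMap_ne_zero_of_trace_eq [IsSimpleModule R V] [IsSimpleModule R W]
    (h : ∀ r : R, LinearMap.trace K V (Algebra.lsmul K K V r) =
      LinearMap.trace K W (Algebra.lsmul K K W r)) : ∃ f : W →ₗ[R] V, f ≠ 0 := by
  have : Nontrivial V := IsSimpleModule.nontrivial R V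
  obtain ⟨v, hv⟩ := exists_ne (0 : V)
  let L : R →ₗ[R] (W → W) := LinearMap.pi fun w => LinearMap.toSpanSingleton R W w
  have hL : ∀ a, L a = 0 → ∀ v : V, a • v = 0 := by
    intro a ha v
    by_contra hav
    obtain ⟨c, hc⟩ := exists_trace_lsmul_mul_ne_zero (K := K) hav
    refine hc ?_
    rw [h]
    convert map_zero (LinearMap.trace K W)
    refine LinearMap.ext fun w => ?_
    have := congrFun ha w
    change a • w = 0 at this
    exact (mul_smul c a w).trans (by rw [this, smul_zero]; rfl)
  let l : R ⧸ LinearMap.ker L →ₗ[R] V :=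
    (LinearMap.ker L).liftQ (LinearMap.toSpanSingleton R V v) fun a ha => hL a ha v
  have : Finite W := Module.finite_of_finite K
  obtain ⟨e, he⟩ := IsSemisimpleModule.extension_property
    ((LinearMap.ker L).liftQ L le_rfl)
    (LinearMap.ker_eq_bot.1 (Submodule.ker_liftQ_eq_bot _ _ _ le_rfl)) l
  classical
  by_contra! h0
  refine hv ?_
  have h1 : l (Submodule.Quotient.mk 1) = v := one_smul R v
  have he0 : e = 0 := LinearMap.pi_ext' fun i => (h0 _).trans (LinearMap.zero_comp _).symm
  rw [← h1, ← he, he0]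
  rfl

end Intertwiner

section MatrixRepresentation

open Matrix

variable {K n G : Type*} [Field K] [Fintype n] [DecidableEq n] [Group G]

/-- The linear representation attached to a matrix representation. -/
def matrixRep (r : G →* Matrix n n K) : Representation K G (n → K) :=
  (toLinAlgEquiv' (R := K) (n := n) : Matrix n n K →* Module.End K (n → K)).comp r

theorem single_smul_asModule_matrixRep (r : G →* Matrix n n K) (g : G) (c : K)
    (v : (matrixRep r).asModule) :
    MonoidAlgebra.single g c • v = (c • (r g *ᵥ v : n → K) : n → K) := by
  change (matrixRep r).asAlgebraHom (MonoidAlgebra.single g c) v = _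
  rw [Representation.asAlgebraHom_single]
  rfl

theorem isSimpleModule_asModule_matrixRep [Nonempty n] (r : G →* Matrix n n K)
    (hr : ∀ M : Submodule K (n → K), (∀ g, ∀ v ∈ M, r g *ᵥ v ∈ M) → M = ⊥ ∨ M = ⊤) :
    IsSimpleModule (MonoidAlgebra K G) (matrixRep r).asModule := by
  have : Nontrivial (matrixRep r).asModule := inferInstanceAs (Nontrivial (n → K))
  refine { eq_bot_or_eq_top := fun P => ?_ }
  refine (hr (P.restrictScalars K) fun g v hv => ?_).imp (fun h => ?_) fun h => ?_
  · have := P.smul_mem (MonoidAlgebra.single g (1 : K)) hv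
    exact (congrArg (· ∈ P) ((single_smul_asModule_matrixRep r g 1 v).trans (one_smul K _))).mp this
  · exact (Submodule.restrictScalars_eq_bot_iff ..).1 h
  · exact (Submodule.restrictScalars_eq_top_iff ..).1 h

/-- Two irreducible matrix representations over a finite field with equal traces are related by a
nonzero matrix. -/
theorem exists_ne_zero_mul_eq_mul_of_trace_eq [Finite K] [Nonempty n] (r₁ r₂ : G →* Matrix n n K)
    (h₁ : ∀ M : Submodule K (n → K), (∀ g, ∀ v ∈ M, r₁ g *ᵥ v ∈ M) → M = ⊥ ∨ M = ⊤)
    (h₂ : ∀ M : Submodule K (n → K), (∀ g, ∀ v ∈ M, r₂ g *ᵥ v ∈ M) → M = ⊥ ∨ M = ⊤)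
    (h : ∀ g, (r₁ g).trace = (r₂ g).trace) :
    ∃ b : Matrix n n K, b ≠ 0 ∧ ∀ g, b * r₁ g = r₂ g * b := by
  have := isSimpleModule_asModule_matrixRep r₁ h₁
  have := isSimpleModule_asModule_matrixRep r₂ h₂
  obtain ⟨f, hf⟩ := exists_linearMap_ne_zero_of_trace_eq (K := K) (R := MonoidAlgebra K G)
    (V := (matrixRep r₂).asModule) (W := (matrixRep r₁).asModule) fun a => by
      induction a using MonoidAlgebra.induction_linear with
      | zero => simp
      | add a b ha hb => rw [map_add, map_add, map_add, map_add, ha, hb]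
      | single g c =>
        have key (r : G →* Matrix n n K) :
            LinearMap.trace K _ (Algebra.lsmul K K (matrixRep r).asModule
              (MonoidAlgebra.single g c)) = c * (r g).trace := by
          have : Algebra.lsmul K K (matrixRep r).asModule (MonoidAlgebra.single g c) =
              (toLin' (c • r g) : (n → K) →ₗ[K] (n → K)) :=
            LinearMap.ext fun v => by
              refine (single_smul_asModule_matrixRep r g c v).trans ?_
              exact (smul_mulVec c (r g) _).symm
          rw [this]
          refine (trace_toLin'_eq _).trans ?_
          rw [trace_smul, smul_eq_mul]
        rw [key, key, h]
  let f' : (n → K) →ₗ[K] (n → K) := f.restrictScalars K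
  refine ⟨LinearMap.toMatrix' f', ?_, fun g => ?_⟩
  · rw [Ne, LinearEquiv.map_eq_zero_iff]
    intro h0
    exact hf (LinearMap.restrictScalars_injective K h0)
  · refine toLin'.injective ?_
    rw [toLin'_mul, toLin'_mul, toLin'_toMatrix']
    refine LinearMap.ext fun v => ?_
    have key (r : G →* Matrix n n K) (v : (matrixRep r).asModule) :
        MonoidAlgebra.single g (1 : K) • v = (r g *ᵥ v : n → K) :=
      (single_smul_asModule_matrixRep r g 1 v).trans (one_smul K _)
    exact (congrArg f (key r₁ v)).symm.trans ((map_smul f _ _).trans (key r₂ _))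

end MatrixRepresentation

section TracePow

open Matrix

variable {K n : Type*} [Field K] [Fintype n] [DecidableEq n]

/-- In characteristic `p` the trace of matrices commutes with `p`-power Frobenius maps. -/
theorem trace_pow_char_pow (p : ℕ) [Fact p.Prime] [CharP K p] (k : ℕ) (A : Matrix n n K) :
    (A ^ p ^ k).trace = A.trace ^ p ^ k := by
  cases isEmpty_or_nonempty n
  · simp [Matrix.trace, (Fact.out : p.Prime).ne_zero]
  have hpk : 0 < p ^ k := pow_pos (Fact.out : p.Prime).pos k
  have h1 : expand K (p ^ k) (A ^ p ^ k).charpoly = A.charpoly ^ p ^ k := by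
    unfold Matrix.charpoly
    rw [AlgHom.map_det, ← coe_detMonoidHom, ← (detMonoidHom : Matrix n n K[X] →* K[X]).map_pow]
    apply congr_arg det
    refine matPolyEquiv.injective ?_
    rw [map_pow, matPolyEquiv_charmatrix, sub_pow_char_pow_of_commute, ← C_pow]
    · exact (id (matPolyEquiv_eq_X_pow_sub_C (p ^ k) A) :)
    · exact (C A).commute_X
  have h2 := congr_arg (fun f => f.coeff ((Fintype.card n - 1) * p ^ k)) h1
  simp only [coeff_expand_mul hpk, ← map_iterateFrobenius_expand p, coeff_map] at h2
  rw [trace_eq_neg_charpoly_coeff, trace_eq_neg_charpoly_coeff, h2, ← iterateFrobenius_def,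
    ← map_neg]

end TracePow

section PrimeToP

open Matrix

/-- The determinant, as a homomorphism on the unitary group. -/
def unitaryDet (n K : Type*) [Fintype n] [DecidableEq n] [CommRing K] [StarRing K] :
    unitaryGroup n K →* K :=
  detMonoidHom.comp (unitaryGroup n K).subtype

theorem unitaryDet_apply {n K : Type*} [Fintype n] [DecidableEq n] [CommRing K] [StarRing K]
    (g : unitaryGroup n K) : unitaryDet n K g = (g : Matrix n n K).det := rfl

theorem star_unitaryDet_mul_self {n K : Type*} [Fintype n] [DecidableEq n] [CommRing K]
    [StarRing K] (g : unitaryGroup n K) : star (unitaryDet n K g) * unitaryDet n K g = 1 := by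
  rw [unitaryDet_apply, ← det_conjTranspose, ← det_mul, ← star_eq_conjTranspose,
    UnitaryGroup.star_mul_self, det_one]

/-- A matrix of finite order invertible in the field is semisimple. -/
theorem isSemisimple_toLin'_of_pow_eq_one {n K : Type*} [Fintype n] [DecidableEq n] [Field K]
    {A : Matrix n n K} {s : ℕ} (hs : (s : K) ≠ 0) (h : A ^ s = 1) :
    Module.End.IsSemisimple (toLin' A) := by
  have hsep : (X ^ s - C (1 : K)).Separable := separable_X_pow_sub_C 1 hs one_ne_zero
  refine Module.End.isSemisimple_of_squarefree_aeval_eq_zero hsep.squarefree ?_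
  rw [map_sub, map_pow, aeval_X, aeval_C, map_one, ← toLin'_pow, h, toLin'_one]
  exact sub_self _

/-- In a finite group, raising to a suitable power of a multiple `N` of `p` lands in the elements
of order prime to `p`. -/
theorem exists_forall_pow_pow_eq_one (G : Type*) [Group G] [Finite G] {p N : ℕ} (hp : p.Prime)
    (hN : p ∣ N) : ∃ a s : ℕ, ¬ p ∣ s ∧ ∀ g : G, (g ^ N ^ a) ^ s = 1 := by
  obtain ⟨a, s, hs, h⟩ := Nat.exists_eq_pow_mul_and_not_dvd (Nat.card_pos (α := G)).ne' p hp.ne_one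
  refine ⟨a, s, hs, fun g => ?_⟩
  rw [← pow_mul]
  obtain ⟨c, hc⟩ : Nat.card G ∣ N ^ a * s := h ▸ mul_dvd_mul_right (pow_dvd_pow_of_dvd hN a) s
  rw [hc, pow_mul, pow_card_eq_one', one_pow]

variable {n K : Type*} [Fintype n] [DecidableEq n] [Nonempty n] [Field K] [Finite K] [StarRing K]

/-- Every unitary conjugate of a semisimple unitary `g` is a special unitary conjugate. -/
theorem exists_unitaryDet_eq_one_conj_eq (hne : ∃ x : K, star x ≠ x) (z g : unitaryGroup n K)
    (hg : Module.End.IsSemisimple (Matrix.toLin' (g : Matrix n n K))) :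
    ∃ s, unitaryDet n K s = 1 ∧ ∀ k : ℕ, s * g ^ k * s⁻¹ = z * g ^ k * z⁻¹ := by
  obtain ⟨c, hcu, hcg, hc⟩ := exists_unitary_commute_det_eq hne (g := (g : Matrix n n K))
    (UnitaryGroup.star_mul_self g) hg (star_unitaryDet_mul_self z⁻¹)
  let c' : unitaryGroup n K := ⟨c, mem_unitaryGroup_iff'.2 hcu⟩
  have hc' : Commute c' g := Subtype.ext hcg
  refine ⟨z * c', ?_, fun k => ?_⟩
  · rw [map_mul, show unitaryDet n K c' = _ from hc, ← map_mul, mul_inv_cancel, map_one]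
  · rw [mul_assoc z, (hc'.pow_right k).eq]
    group

/-- A semisimple element of the unitary group over `𝔽_{q²}` is conjugate to its `(-q)`-th power
under the special unitary group. -/
theorem exists_unitaryDet_eq_one_conj_pow_eq_inv {p b q : ℕ} [Fact p.Prime] [CharP K p]
    (hq : q = p ^ b) (hstar : ∀ x : K, star x = x ^ q) (hne : ∃ x : K, star x ≠ x)
    (g : unitaryGroup n K) (hg : Module.End.IsSemisimple (Matrix.toLin' (g : Matrix n n K))) :
    ∃ s, unitaryDet n K s = 1 ∧ s * g ^ q * s⁻¹ = g⁻¹ := by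
  obtain ⟨z, hzu, hz⟩ := exists_unitary_mul_pow_eq hq hstar hne (g := (g : Matrix n n K))
    (UnitaryGroup.star_mul_self g) hg
  let z' : unitaryGroup n K := ⟨z, mem_unitaryGroup_iff'.2 hzu⟩
  have hz' : z' * g ^ q = g⁻¹ * z' := Subtype.ext hz
  obtain ⟨s, hs1, hs⟩ := exists_unitaryDet_eq_one_conj_eq hne z' g hg
  exact ⟨s, hs1, by rw [hs, hz', mul_inv_cancel_right]⟩

variable {p b q : ℕ} [Fact p.Prime] [CharP K p]

/-- For any representation over `𝔽_{q²}` of the special unitary group, the trace of the inverse of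
an element is the conjugate of its trace. -/
theorem star_trace_map_inv {ι : Type*} [Fintype ι] [DecidableEq ι] (hb : 0 < b)
    (hq : q = p ^ b) (hcard : Nat.card K = q ^ 2) (hstar : ∀ x : K, star x = x ^ q)
    (hne : ∃ x : K, star x ≠ x) (r : (unitaryDet n K).ker →* Matrix ι ι K)
    (g : (unitaryDet n K).ker) : star (r g⁻¹).trace = (r g).trace := by
  have : Fintype K := Fintype.ofFinite K
  have hp : p.Prime := Fact.out
  have hpN : p ∣ q ^ 2 := by
    rw [hq, ← pow_mul]
    exact dvd_pow_self p (by positivity)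
  obtain ⟨a, s, hs, has⟩ := exists_forall_pow_pow_eq_one (unitaryDet n K).ker hp hpN
  have hs0 : (s : K) ≠ 0 := fun h => hs ((CharP.cast_eq_zero_iff K p s).1 h)
  have hN : (q ^ 2) ^ a = p ^ (b * (2 * a)) := by rw [hq, ← pow_mul, ← pow_mul]
  have hfix (x : K) : x ^ (q ^ 2) ^ a = x := by
    rw [← hcard, Nat.card_eq_fintype_card, FiniteField.pow_card_pow]
  have htr (g : (unitaryDet n K).ker) : (r g).trace = (r (g ^ (q ^ 2) ^ a)).trace := by
    rw [map_pow, hN, trace_pow_char_pow, ← hN, hfix]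
  rw [htr g, htr g⁻¹, inv_pow]
  set h := g ^ (q ^ 2) ^ a with hh
  have hss : Module.End.IsSemisimple (Matrix.toLin' ((h : unitaryGroup n K) : Matrix n n K)) :=
    isSemisimple_toLin'_of_pow_eq_one hs0
      (congrArg (fun x : (unitaryDet n K).ker => ((x : unitaryGroup n K) : Matrix n n K)) (has g))
  obtain ⟨z, hz1, hz⟩ := exists_unitaryDet_eq_one_conj_pow_eq_inv hq hstar hne (h : unitaryGroup n K)
    hss
  let z' : (unitaryDet n K).ker := ⟨z, hz1⟩
  have hz' : z' * h ^ q * z'⁻¹ = h⁻¹ := Subtype.ext hz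
  have h1 : (r h⁻¹).trace = (r h).trace ^ q := by
    rw [← hz', map_mul, trace_mul_comm, ← map_mul, inv_mul_cancel_left, map_pow, hq,
      trace_pow_char_pow]
  rw [h1, ← hstar, star_star]

end PrimeToP

section InvariantForm

open Matrix

variable {G K n : Type*} [Group G] [Field K] [StarRing K] [Fintype n] [DecidableEq n]

/-- The conjugate dual of a matrix representation. -/
def conjDualRep (r : G →* Matrix n n K) : G →* Matrix n n K where
  toFun g := (r g⁻¹)ᴴ
  map_one' := by simp
  map_mul' g h := by simp

theorem conjTranspose_mul_conjDualRep (r : G →* Matrix n n K) (g : G) :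
    (r g)ᴴ * conjDualRep r g = 1 := by
  change (r g)ᴴ * (r g⁻¹)ᴴ = 1
  rw [← conjTranspose_mul, ← map_mul, inv_mul_cancel, map_one, conjTranspose_one]

theorem irreducible_conjDualRep [Finite K] (r : G →* Matrix n n K)
    (h : ∀ M : Submodule K (n → K), (∀ g, ∀ v ∈ M, r g *ᵥ v ∈ M) → M = ⊥ ∨ M = ⊤)
    (M : Submodule K (n → K)) (hM : ∀ g, ∀ v ∈ M, conjDualRep r g *ᵥ v ∈ M) :
    M = ⊥ ∨ M = ⊤ := by
  have hrank := finrank_add_finrank_hermPerp M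
  have hinv : ∀ g, ∀ v ∈ hermPerp M, r g *ᵥ v ∈ hermPerp M := by
    intro g v hv s hs
    rw [← conjTranspose_conjTranspose (r g), ← mulVec_dotProduct_star]
    refine hv _ ?_
    have := hM g⁻¹ s hs
    rwa [show conjDualRep r g⁻¹ = (r g)ᴴ from by simp [conjDualRep]] at this
  rcases h (hermPerp M) hinv with h0 | h0
  · rw [h0, finrank_bot, add_zero] at hrank
    exact Or.inr (Submodule.eq_top_of_finrank_eq
      (hrank.trans (Module.finrank_fintype_fun_eq_card K).symm))
  · rw [h0, finrank_top, Module.finrank_fintype_fun_eq_card] at hrank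
    exact Or.inl (Submodule.finrank_eq_zero.1 (by omega))

/-- An irreducible representation with conjugate-symmetric trace preserves a nondegenerate
Hermitian form. -/
theorem exists_hermitian_invariant [Finite K] [Nonempty n] (hne : ∃ x : K, star x ≠ x)
    (r : G →* Matrix n n K)
    (h : ∀ M : Submodule K (n → K), (∀ g, ∀ v ∈ M, r g *ᵥ v ∈ M) → M = ⊥ ∨ M = ⊤)
    (htr : ∀ g, star (r g⁻¹).trace = (r g).trace) :
    ∃ y : Matrix n n K, yᴴ = y ∧ IsUnit y ∧ ∀ g, (r g)ᴴ * y * r g = y := by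
  obtain ⟨c, hc0, hc⟩ := exists_ne_zero_mul_eq_mul_of_trace_eq r (conjDualRep r) h
    (irreducible_conjDualRep r h) fun g => by rw [← htr]; exact (trace_conjTranspose _).symm
  have hinv (g : G) : (r g)ᴴ * c * r g = c := by
    rw [mul_assoc, hc, ← mul_assoc, conjTranspose_mul_conjDualRep, one_mul]
  have hinv' (g : G) : (r g)ᴴ * cᴴ * r g = cᴴ := by
    simpa [mul_assoc] using congrArg conjTranspose (hinv g)
  obtain ⟨y, hy0, hyy, hy⟩ : ∃ y : Matrix n n K, y ≠ 0 ∧ yᴴ = y ∧ ∀ g, (r g)ᴴ * y * r g = y := by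
    by_cases hcc : c + cᴴ = 0
    · obtain ⟨x, hx⟩ := hne
      refine ⟨(x - star x) • c, smul_ne_zero (sub_ne_zero.2 hx.symm) hc0, ?_, fun g => ?_⟩
      · rw [conjTranspose_smul, eq_neg_of_add_eq_zero_right hcc, star_sub, star_star, smul_neg,
          ← neg_smul, neg_sub]
      · rw [mul_smul_comm, smul_mul_assoc, hinv]
    · refine ⟨c + cᴴ, hcc, ?_, fun g => ?_⟩
      · rw [conjTranspose_add, conjTranspose_conjTranspose, add_comm]
      · rw [mul_add, add_mul, hinv, hinv']
  refine ⟨y, hyy, ?_, hy⟩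
  have hy2 (g : G) : y * r g = conjDualRep r g * y := by
    have h1 := mul_eq_one_comm.1 (conjTranspose_mul_conjDualRep r g)
    rw [← one_mul (y * r g), ← h1, mul_assoc, ← mul_assoc _ y, hy]
  have hker := h (LinearMap.ker (toLin' y)) fun g v hv => by
    rw [LinearMap.mem_ker, toLin'_apply] at hv ⊢
    rw [mulVec_mulVec, hy2, ← mulVec_mulVec, hv, mulVec_zero]
  rcases hker with hk | hk
  · exact mulVec_injective_iff_isUnit.1 (LinearMap.ker_eq_bot.1 hk)
  · exact absurd (toLin'.map_eq_zero_iff.1 (LinearMap.ker_eq_top.1 hk)) hy0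

end InvariantForm

section Reflections

open Matrix

variable {K n : Type*} [Field K] [StarRing K] [Fintype n] [DecidableEq n]

/-- The rank-one perturbation `x ↦ x + c β(x, w) w` of the identity. -/
def hermReflection (w : n → K) (c : K) : Matrix n n K :=
  1 + c • vecMulVec w (star w)

theorem hermReflection_mulVec (w : n → K) (c : K) (x : n → K) :
    hermReflection w c *ᵥ x = x + (c * (x ⬝ᵥ star w)) • w := by
  rw [hermReflection, add_mulVec, one_mulVec, smul_mulVec, vecMulVec_mulVec, dotProduct_comm,
    op_smul_eq_smul, smul_smul]

theorem hermReflection_mem_unitaryGroup {w : n → K} {c : K}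
    (h : c + star c + c * star c * (w ⬝ᵥ star w) = 0) :
    hermReflection w c ∈ unitaryGroup n K := by
  rw [mem_unitaryGroup_iff', star_eq_conjTranspose]
  have h1 : (hermReflection w c)ᴴ = 1 + star c • vecMulVec w (star w) := by
    rw [hermReflection, conjTranspose_add, conjTranspose_one, conjTranspose_smul,
      conjTranspose_vecMulVec, star_star]
  have h2 : vecMulVec w (star w) * vecMulVec w (star w) =
      (w ⬝ᵥ star w) • vecMulVec w (star w) := by
    rw [vecMulVec_mul_vecMulVec, dotProduct_comm]
    ext i j
    simp [vecMulVec_apply]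
    ring
  rw [h1, hermReflection, add_mul, one_mul, mul_add, mul_one, smul_mul_smul_comm, h2, smul_smul,
    add_assoc, ← add_smul, ← add_smul,
    show c + (star c + star c * c * w ⬝ᵥ star w) = 0 by linear_combination h, zero_smul, add_zero]

theorem unitary_mulVec_dotProduct_star (g : unitaryGroup n K) (u v : n → K) :
    ((g : Matrix n n K) *ᵥ u) ⬝ᵥ star ((g : Matrix n n K) *ᵥ v) = u ⬝ᵥ star v := by
  rw [mulVec_dotProduct_star, mulVec_mulVec, ← star_eq_conjTranspose, UnitaryGroup.star_mul_self,
    one_mulVec]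

/-- A subgroup containing all unitary reflections and transvections can move any unit vector to any
other one, while fixing the vectors orthogonal to both. -/
theorem exists_mem_mulVec_eq (hne : ∃ x : K, star x ≠ x) {N : Subgroup (unitaryGroup n K)}
    (hN : ∀ (w : n → K) (c : K) (h : hermReflection w c ∈ unitaryGroup n K),
      (⟨_, h⟩ : unitaryGroup n K) ∈ N)
    {u v : n → K} (hu : u ⬝ᵥ star u = 1) (hv : v ⬝ᵥ star v = 1) :
    ∃ h ∈ N, (h : Matrix n n K) *ᵥ u = v ∧
      ∀ x, x ⬝ᵥ star u = 0 → x ⬝ᵥ star v = 0 → (h : Matrix n n K) *ᵥ x = x := by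
  have main {u v : n → K} (hu : u ⬝ᵥ star u = 1) (hv : v ⬝ᵥ star v = 1)
      (huv : u ⬝ᵥ star v ≠ 1) :
      ∃ h ∈ N, (h : Matrix n n K) *ᵥ u = v ∧
        ∀ x, x ⬝ᵥ star u = 0 → x ⬝ᵥ star v = 0 → (h : Matrix n n K) *ᵥ x = x := by
    have h1 : 1 - u ⬝ᵥ star v ≠ 0 := sub_ne_zero.2 huv.symm
    have h2 : 1 - star (u ⬝ᵥ star v) ≠ 0 := by
      rw [← star_one K, ← star_sub]
      exact star_ne_zero.2 h1
    have huni : hermReflection (u - v) (-(1 - u ⬝ᵥ star v)⁻¹) ∈ unitaryGroup n K := by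
      refine hermReflection_mem_unitaryGroup ?_
      have : (u - v) ⬝ᵥ star (u - v) = 2 - u ⬝ᵥ star v - star (u ⬝ᵥ star v) := by
        rw [star_sub, sub_dotProduct, dotProduct_sub, dotProduct_sub, hu, hv,
          dotProduct_star_comm u v]
        ring
      rw [this, star_neg, star_inv₀, star_sub, star_one]
      field_simp
      ring
    refine ⟨_, hN _ _ huni, ?_, fun x hxu hxv => ?_⟩
    · rw [hermReflection_mulVec, star_sub, dotProduct_sub, hu, neg_mul, inv_mul_cancel₀ h1,
        neg_smul, one_smul]
      abel
    · rw [hermReflection_mulVec, star_sub, dotProduct_sub, hxu, hxv, sub_zero, mul_zero, zero_smul,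
        add_zero]
  by_cases huv : u ⬝ᵥ star v = 1
  · obtain ⟨l, hl1, hl⟩ : ∃ l : K, l ≠ 1 ∧ l * star l = 1 := by
      obtain ⟨x, hx⟩ := hne
      have hx0 : x ≠ 0 := by
        rintro rfl
        exact hx (star_zero K)
      have hx0' : star x ≠ 0 := star_ne_zero.2 hx0
      refine ⟨star x / x, fun h => hx ((div_eq_one_iff_eq hx0).1 h), ?_⟩
      rw [star_div₀, star_star]
      field_simp
    have huni : hermReflection u (l - 1) ∈ unitaryGroup n K := by
      refine hermReflection_mem_unitaryGroup ?_
      rw [hu, star_sub, star_one]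
      linear_combination hl
    obtain ⟨h, hhN, hh, hx⟩ := main (u := l • u) (v := v)
      (by rw [star_smul, smul_dotProduct, dotProduct_smul, hu]; simpa using hl) hv
      (by rw [smul_dotProduct, huv]; simpa using hl1)
    refine ⟨h * ⟨_, huni⟩, N.mul_mem hhN (hN _ _ huni), ?_, fun x hxu hxv => ?_⟩
    · rw [UnitaryGroup.mul_val, ← mulVec_mulVec, hermReflection_mulVec, hu, mul_one, ← hh]
      congr 1
      rw [sub_smul, one_smul]
      abel
    · rw [UnitaryGroup.mul_val, ← mulVec_mulVec, hermReflection_mulVec, hxu, mul_zero, zero_smul,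
        add_zero]
      exact hx x (by rw [star_smul, dotProduct_smul, hxu, smul_zero]) hxv
  · exact main hu hv huv

/-- The unitary group is generated by reflections and transvections. -/
theorem eq_top_of_forall_hermReflection_mem (hne : ∃ x : K, star x ≠ x)
    {N : Subgroup (unitaryGroup n K)}
    (hN : ∀ (w : n → K) (c : K) (h : hermReflection w c ∈ unitaryGroup n K),
      (⟨_, h⟩ : unitaryGroup n K) ∈ N) : N = ⊤ := by
  refine eq_top_iff.2 fun z _ => ?_
  have he (i j : n) : (Pi.single i 1 : n → K) ⬝ᵥ star (Pi.single j 1 : n → K) =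
      if i = j then 1 else 0 := by
    rw [single_one_dotProduct, Pi.star_apply, Pi.single_apply]
    split_ifs <;> simp
  have key (T : Finset n) : ∃ h ∈ N, ∀ i ∈ T,
      ((h * z : unitaryGroup n K) : Matrix n n K) *ᵥ Pi.single i 1 = Pi.single i 1 := by
    induction T using Finset.induction_on with
    | empty => exact ⟨1, N.one_mem, by simp⟩
    | insert i T hi ih =>
      obtain ⟨h, hhN, hh⟩ := ih
      obtain ⟨h', hhN', hh', hx⟩ := exists_mem_mulVec_eq hne hN
        (u := ((h * z : unitaryGroup n K) : Matrix n n K) *ᵥ Pi.single i 1)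
        (v := Pi.single i 1)
        (by rw [unitary_mulVec_dotProduct_star, he, if_pos rfl]) (by rw [he, if_pos rfl])
      refine ⟨h' * h, N.mul_mem hhN' hhN, fun j hj => ?_⟩
      rw [mul_assoc, UnitaryGroup.mul_val, ← mulVec_mulVec]
      rcases Finset.mem_insert.1 hj with rfl | hj
      · exact hh'
      · have hji : j ≠ i := fun h => hi (h ▸ hj)
        rw [hh j hj]
        refine hx _ ?_ (by rw [he, if_neg hji])
        rw [← hh j hj, unitary_mulVec_dotProduct_star, he, if_neg hji]
  obtain ⟨h, hhN, hh⟩ := key Finset.univ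
  have : h * z = 1 := Subtype.ext (ext_of_mulVec_single fun i => by
    rw [hh i (Finset.mem_univ i), UnitaryGroup.one_val, one_mulVec])
  rw [← inv_eq_of_mul_eq_one_right this]
  exact N.inv_mem hhN

end Reflections

section ExtendHom

variable {U A M : Type*} [Group U] [Monoid A] [CommMonoid M]

/-- A conjugation-invariant homomorphism on the kernel of a split homomorphism `D`
extends to a homomorphism which is trivial on the splitting. -/
theorem exists_monoidHom_extending_ker {D : U →* A} {s : U →* U}
    (hDs : ∀ z, D (s z) = D z) (hs : ∀ z, D z = 1 → s z = 1) (χ : D.ker →* M)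
    (hχ : ∀ (z : U) (g h : D.ker), (h : U) = z * g * z⁻¹ → χ h = χ g) :
    ∃ ψ : U →* M, (∀ g : D.ker, ψ g = χ g) ∧ ∀ z, ψ (s z) = 1 := by
  have hmem (z : U) : z * (s z)⁻¹ ∈ D.ker := by
    rw [MonoidHom.mem_ker, map_mul, ← hDs, ← map_mul, mul_inv_cancel, map_one]
  have hval (z : U) (h : z * (s z)⁻¹ = 1) : χ ⟨_, hmem z⟩ = 1 := by
    rw [← map_one χ]
    exact congrArg χ (Subtype.ext h)
  let ψ : U →* M :=
    { toFun z := χ ⟨_, hmem z⟩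
      map_one' := hval 1 (by rw [map_one, inv_one, mul_one])
      map_mul' z w := by
        have h1 : (⟨_, hmem (z * w)⟩ : D.ker) =
            (⟨z * (w * (s w)⁻¹) * z⁻¹, D.normal_ker.conj_mem _ (hmem w) z⟩ : D.ker) *
              ⟨_, hmem z⟩ := by
          refine Subtype.ext ?_
          change z * w * (s (z * w))⁻¹ = z * (w * (s w)⁻¹) * z⁻¹ * (z * (s z)⁻¹)
          rw [map_mul]
          group
        rw [h1, map_mul, hχ z ⟨_, hmem w⟩ _ rfl, mul_comm] }
  refine ⟨ψ, fun g => congrArg χ (Subtype.ext ?_), fun z => hval _ ?_⟩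
  · change (g : U) * (s g)⁻¹ = g
    rw [hs _ g.2, inv_one, mul_one]
  · have h1 : s (s z * z⁻¹) = 1 := hs _ (by
      rw [map_mul, hDs, ← map_mul, mul_inv_cancel, map_one])
    rw [map_mul, map_inv] at h1
    rw [eq_of_mul_inv_eq_one h1, mul_inv_cancel]

end ExtendHom

section DetTrivial

open Matrix

theorem hermReflection_single {n K : Type*} [DecidableEq n] [Field K] [StarRing K] (i : n) (c : K) :
    hermReflection (Pi.single i 1) c = diagonal (Pi.mulSingle i (1 + c)) := by
  ext j k
  rw [hermReflection, Matrix.add_apply, Matrix.smul_apply, vecMulVec_apply, diagonal_apply, one_apply]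
  by_cases hj : j = i <;> by_cases hk : k = i <;> by_cases hjk : j = k <;> simp_all

variable {n K : Type*} [Fintype n] [DecidableEq n] [Field K] [StarRing K]

/-- The splitting of the determinant on the unitary group by diagonal matrices, as an
endomorphism. -/
def unitaryDetSplitting (i : n) : unitaryGroup n K →* unitaryGroup n K where
  toFun z := ⟨diagonal (Pi.mulSingle i (unitaryDet n K z)), by
    rw [mem_unitaryGroup_iff', star_eq_conjTranspose, diagonal_conjTranspose, diagonal_mul_diagonal,
      ← diagonal_one]
    congr 1
    ext j
    obtain rfl | hj := eq_or_ne j i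
    · simpa using star_unitaryDet_mul_self z
    · simp [hj]⟩
  map_one' := Subtype.ext (by simp)
  map_mul' z w := Subtype.ext (by
    simp only [UnitaryGroup.mul_val, map_mul, Pi.mulSingle_mul, diagonal_mul_diagonal']
    rfl)

theorem unitaryDet_unitaryDetSplitting (i : n) (z : unitaryGroup n K) :
    unitaryDet n K (unitaryDetSplitting i z) = unitaryDet n K z := by
  rw [unitaryDet_apply]
  change (diagonal _).det = _
  rw [det_diagonal, Finset.prod_pi_mulSingle', if_pos (Finset.mem_univ i)]

theorem unitaryDetSplitting_eq_one {i : n} {z : unitaryGroup n K} (h : unitaryDet n K z = 1) :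
    unitaryDetSplitting i z = 1 :=
  Subtype.ext (by
    change diagonal (Pi.mulSingle i (unitaryDet n K z)) = 1
    rw [h, Pi.mulSingle_one]
    exact diagonal_one)

theorem exists_unitary_col_eq (hne : ∃ x : K, star x ≠ x) (i : n) {v : n → K}
    (hv : v ⬝ᵥ star v = 1) : ∃ z : unitaryGroup n K, (z : Matrix n n K) *ᵥ Pi.single i 1 = v := by
  obtain ⟨z, -, hz, -⟩ := exists_mem_mulVec_eq hne (N := ⊤) (fun _ _ _ => Subgroup.mem_top _)
    (u := Pi.single i 1) (by simp) hv
  exact ⟨z, hz⟩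

theorem unitary_mul_hermReflection_mul (z : unitaryGroup n K) (w : n → K) (c : K) :
    (z : Matrix n n K) * hermReflection w c * star (z : Matrix n n K) =
      hermReflection ((z : Matrix n n K) *ᵥ w) c := by
  rw [hermReflection, mul_add, mul_one, add_mul, mem_unitaryGroup_iff.1 z.2, mul_smul_comm,
    smul_mul_assoc, mul_vecMulVec, vecMulVec_mul, hermReflection, star_mulVec,
    star_eq_conjTranspose]

/-- A homomorphism to the field from the unitary group which is trivial on the diagonal splitting of
the determinant is trivial. -/
theorem monoidHom_unitaryGroup_eq_one [Finite K] {p : ℕ} [Fact p.Prime] [CharP K p]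
    (hne : ∃ x : K, star x ≠ x) (i : n) (ψ : unitaryGroup n K →* K)
    (hψ : ∀ z, ψ (unitaryDetSplitting i z) = 1) : ψ = 1 := by
  refine MonoidHom.ker_eq_top_iff.1 (eq_top_of_forall_hermReflection_mem hne fun w c h => ?_)
  rw [MonoidHom.mem_ker]
  by_cases hw : w ⬝ᵥ star w = 0
  · have h1 : (⟨_, h⟩ : unitaryGroup n K) ^ p = 1 := by
      refine Subtype.ext ?_
      change hermReflection w c ^ p = 1
      have h2 : (c • vecMulVec w (star w)) ^ 2 = 0 := by
        rw [sq, smul_mul_smul_comm, vecMulVec_mul_vecMulVec, dotProduct_comm, hw]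
        simp
      cases isEmpty_or_nonempty n
      · exact Subsingleton.elim _ _
      rw [hermReflection, add_pow_char_of_commute _ (Commute.one_left _), one_pow,
        pow_eq_zero_of_le (Fact.out : p.Prime).two_le h2, add_zero]
    have h3 := congrArg ψ h1
    rw [map_pow, map_one, ← one_pow p] at h3
    exact frobenius_inj K p h3
  · obtain ⟨a, ha⟩ := exists_mul_involution_eq (starRingEnd K) star_star hne
      (dotProduct_star_comm w w).symm
    have ha0 : a ≠ 0 := by
      rintro rfl
      rw [zero_mul] at ha
      exact hw ha.symm
    have ha0' : star a ≠ 0 := star_ne_zero.2 ha0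
    obtain ⟨z, hz⟩ := exists_unitary_col_eq hne i (v := a⁻¹ • w) (by
      rw [star_smul, smul_dotProduct, dotProduct_smul, ← ha, star_inv₀, smul_eq_mul, smul_eq_mul,
        starRingEnd_apply]
      field_simp)
    have h1 : hermReflection w c = hermReflection (a⁻¹ • w) (c * (a * star a)) := by
      rw [hermReflection, hermReflection, star_smul, smul_vecMulVec, vecMulVec_smul, smul_smul,
        star_inv₀, smul_smul]
      congr 2
      field_simp
    let t : unitaryGroup n K := ⟨_, h⟩
    have ht0 : ((z⁻¹ * t * z : unitaryGroup n K) : Matrix n n K) =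
        diagonal (Pi.mulSingle i (1 + c * (a * star a))) := by
      have h2 := unitary_mul_hermReflection_mul z⁻¹ (a⁻¹ • w) (c * (a * star a))
      rw [← hz, mulVec_mulVec, ← UnitaryGroup.mul_val, inv_mul_cancel, UnitaryGroup.one_val,
        one_mulVec, hermReflection_single, hz, ← h1, UnitaryGroup.inv_val, star_star] at h2
      exact h2
    have hdet : unitaryDet n K (z⁻¹ * t * z) = 1 + c * (a * star a) := by
      rw [unitaryDet_apply, ht0, det_diagonal, Finset.prod_pi_mulSingle',
        if_pos (Finset.mem_univ i)]
    have hfix : unitaryDetSplitting i (z⁻¹ * t * z) = z⁻¹ * t * z := by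
      refine Subtype.ext ?_
      change diagonal (Pi.mulSingle i (unitaryDet n K (z⁻¹ * t * z))) = _
      rw [hdet, ht0]
    have hone : ψ (z⁻¹ * t * z) = 1 := hfix ▸ hψ _
    rw [mul_assoc, map_mul, map_mul, mul_left_comm, ← map_mul, inv_mul_cancel, map_one,
      mul_one] at hone
    exact hone

/-- The special unitary group over `𝔽_{q²}` has no nontrivial homomorphism to the field. -/
theorem monoidHom_ker_unitaryDet_eq_one [Finite K] [Nonempty n] {p : ℕ} [Fact p.Prime] [CharP K p]
    (hne : ∃ x : K, star x ≠ x) (χ : (unitaryDet n K).ker →* K) : χ = 1 := by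
  have : Fintype K := Fintype.ofFinite K
  obtain ⟨i⟩ := ‹Nonempty n›
  have : Nonempty n := ⟨i⟩
  have hpN : p ∣ Fintype.card K := (CharP.cast_eq_zero_iff K p _).1 (Nat.cast_card_eq_zero K)
  obtain ⟨a, s, hs, has⟩ := exists_forall_pow_pow_eq_one (unitaryDet n K).ker Fact.out hpN
  have hs0 : (s : K) ≠ 0 := fun h => hs ((CharP.cast_eq_zero_iff K p s).1 h)
  have hpow (g : (unitaryDet n K).ker) : χ g = χ (g ^ Fintype.card K ^ a) := by
    rw [map_pow, FiniteField.pow_card_pow]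
  obtain ⟨ψ, hψ, hψ'⟩ := exists_monoidHom_extending_ker (unitaryDet_unitaryDetSplitting i)
    (fun z => unitaryDetSplitting_eq_one (i := i)) χ fun z g h hgh => by
      rw [hpow g, hpow h]
      have hss : Module.End.IsSemisimple
          (Matrix.toLin' (((g ^ Fintype.card K ^ a : (unitaryDet n K).ker) : unitaryGroup n K) :
            Matrix n n K)) :=
        isSemisimple_toLin'_of_pow_eq_one hs0 (congrArg
          (fun x : (unitaryDet n K).ker => ((x : unitaryGroup n K) : Matrix n n K)) (has g))
      obtain ⟨s, hs1, hs⟩ := exists_unitaryDet_eq_one_conj_eq hne z _ hss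
      let s' : (unitaryDet n K).ker := ⟨s, hs1⟩
      have h1 : h ^ Fintype.card K ^ a = s' * g ^ Fintype.card K ^ a * s'⁻¹ := by
        refine Subtype.ext ?_
        have h2 := hs 1
        rw [pow_one] at h2
        refine Eq.trans ?_ h2.symm
        rw [SubmonoidClass.coe_pow, hgh, conj_pow]
        rfl
      rw [h1, map_mul, map_mul, mul_right_comm, ← map_mul, mul_inv_cancel, map_one, one_mul]
  ext g
  rw [← hψ, monoidHom_unitaryGroup_eq_one (p := p) hne i ψ hψ']
  rfl

end DetTrivial

theorem exists_star_ne {K : Type*} [Field K] [Fintype K] [StarRing K] {q : ℕ}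
    (hstar : ∀ x : K, star x = x ^ q) (hq : 1 < q) (hK : Fintype.card K = q ^ 2) :
    ∃ x : K, star x ≠ x := by
  by_contra! h
  have hne : (X ^ q - X : K[X]) ≠ 0 := FiniteField.X_pow_card_sub_X_ne_zero K hq
  have h1 : Fintype.card K ≤ (X ^ q - X : K[X]).natDegree := by
    rw [← Finset.card_univ]
    refine Polynomial.card_le_degree_of_subset_roots fun x _ => ?_
    exact (mem_roots hne).2 (by simp [← hstar, h])
  rw [FiniteField.X_pow_card_sub_X_natDegree_eq K hq, hK] at h1
  nlinarith

section SpecialUnitary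

open Matrix

variable {n K : Type*} [Fintype n] [DecidableEq n] [Nonempty n] [Field K] [Finite K] [StarRing K]

/-- An irreducible representation of the special unitary group over `𝔽_{q²}` of its natural
dimension is, after a change of basis, special unitary. -/
theorem exists_conjTranspose_mul_invariant {p b q : ℕ} [Fact p.Prime] [CharP K p] (hb : 0 < b)
    (hq : q = p ^ b) (hcard : Nat.card K = q ^ 2) (hstar : ∀ x : K, star x = x ^ q)
    (hne : ∃ x : K, star x ≠ x) (r : (unitaryDet n K).ker →* Matrix n n K)
    (h : ∀ M : Submodule K (n → K), (∀ g, ∀ v ∈ M, r g *ᵥ v ∈ M) → M = ⊥ ∨ M = ⊤) :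
    ∃ a : GL n K, ∀ g, (r g)ᴴ * ((a : Matrix n n K)ᴴ * a) * r g = (a : Matrix n n K)ᴴ * a ∧
      (r g).det = 1 := by
  obtain ⟨y, hy, hyu, hinv⟩ := exists_hermitian_invariant hne r h
    (star_trace_map_inv hb hq hcard hstar hne r)
  obtain ⟨a, rfl, ⟨a, rfl⟩, -⟩ := exists_conjTranspose_mul_self_eq hne hy hyu
  exact ⟨a, fun g => ⟨hinv g, DFunLike.congr_fun
    (monoidHom_ker_unitaryDet_eq_one (p := p) hne (detMonoidHom.comp r)) g⟩⟩

theorem mem_SUgroup_iff {K : Type*} [Field K] [StarRing K] {q m : ℕ}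
    (hstar : ∀ x : K, star x = x ^ q) {g : GL (Fin m) K} :
    g ∈ SUgroup K q m ↔ (g : Matrix (Fin m) (Fin m) K).det = 1 ∧
      (g : Matrix (Fin m) (Fin m) K)ᴴ * g = 1 := by
  have hform (u v : Fin m → K) : stdHerm K q m u v = u ⬝ᵥ star v := by
    simp [stdHerm, dotProduct, hstar]
  refine and_congr_right fun _ => ⟨fun h => ?_, fun h u v => ?_⟩
  · refine eq_of_forall_dotProduct_star fun u v => ?_
    rw [← mulVec_mulVec, mulVec_dotProduct_star, conjTranspose_conjTranspose, ← hform, h, hform,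
      one_mulVec]
  · rw [hform, hform, mulVec_dotProduct_star, mulVec_mulVec, h, one_mulVec]

/-- The special unitary matrices as a subgroup of the general linear group. -/
def kerUnitaryDetToSUgroup {K : Type*} [Field K] [StarRing K] {q m : ℕ}
    (hstar : ∀ x : K, star x = x ^ q) : (unitaryDet (Fin m) K).ker →* SUgroup K q m :=
  (Unitary.toUnits.comp (unitaryDet (Fin m) K).ker.subtype).codRestrict _ fun g =>
    (mem_SUgroup_iff hstar).2 ⟨g.2, UnitaryGroup.star_mul_self g.1⟩

theorem kerUnitaryDetToSUgroup_surjective {K : Type*} [Field K] [StarRing K] {q m : ℕ}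
    (hstar : ∀ x : K, star x = x ^ q) :
    Function.Surjective (kerUnitaryDetToSUgroup (m := m) hstar) := fun g =>
  have h := (mem_SUgroup_iff hstar).1 g.2
  ⟨⟨⟨g.1.1, mem_unitaryGroup_iff'.2 h.2⟩, h.1⟩, Subtype.ext (Units.ext rfl)⟩

/-- The `q`-power map as the conjugation of a field with `q²` elements. -/
@[reducible]
def powStarRing (p b q : ℕ) [Fact p.Prime] (K : Type*) [Field K] [Fintype K] [CharP K p]
    (hq : q = p ^ b) (hK : Fintype.card K = q ^ 2) : StarRing K where
  star x := x ^ q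
  star_involutive x := by
    change (x ^ q) ^ q = x
    rw [← pow_mul, ← sq, ← hK, FiniteField.pow_card]
  star_mul x y := by
    change (x * y) ^ q = y ^ q * x ^ q
    rw [mul_pow, mul_comm]
  star_add x y := by
    change (x + y) ^ q = x ^ q + y ^ q
    rw [hq, add_pow_char_pow]

/-- If conjugation by `a` makes the image of a faithful representation of `SU_m(q)` special unitary,
then the form `β(a u, a v)` is invariant and conjugation by `a` maps the image onto `SU_m(q)`. -/
theorem exists_form_and_conj_eq_SUgroup {K : Type*} [Field K] [Finite K] [StarRing K] {q m : ℕ}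
    (hstar : ∀ x : K, star x = x ^ q) (ρ : SUgroup K q m →* GL (Fin m) K)
    (hρ : Function.Injective ρ) (a : GL (Fin m) K)
    (ha : ∀ g, (ρ g : Matrix (Fin m) (Fin m) K)ᴴ * ((a : Matrix (Fin m) (Fin m) K)ᴴ * a) * ρ g =
      (a : Matrix (Fin m) (Fin m) K)ᴴ * a ∧ (ρ g : Matrix (Fin m) (Fin m) K).det = 1) :
    (∃ β : (Fin m → K) → (Fin m → K) → K,
      (∀ u u' v, β (u + u') v = β u v + β u' v) ∧
      (∀ u v v', β u (v + v') = β u v + β u v') ∧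
      (∀ (lam : K) u v, β (lam • u) v = lam * β u v) ∧
      (∀ (lam : K) u v, β u (lam • v) = lam ^ q * β u v) ∧
      (∀ u v, β v u = (β u v) ^ q) ∧
      (∀ u, (∀ v, β u v = 0) → u = 0) ∧
      (∀ g : SUgroup K q m, ∀ u v, β ((ρ g : Matrix (Fin m) (Fin m) K) *ᵥ u)
        ((ρ g : Matrix (Fin m) (Fin m) K) *ᵥ v) = β u v)) ∧
    (∃ t : GL (Fin m) K,
      Subgroup.map (MulAut.conj t).toMonoidHom (MonoidHom.range ρ) = SUgroup K q m) := by
  let A : Matrix (Fin m) (Fin m) K := a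
  have hA : IsUnit A := a.isUnit
  obtain ⟨β, hβ⟩ : ∃ β : (Fin m → K) → (Fin m → K) → K,
      ∀ u v, β u v = (A *ᵥ u) ⬝ᵥ star (A *ᵥ v) := ⟨_, fun _ _ => rfl⟩
  refine ⟨⟨β, ?_, ?_, ?_, ?_, ?_, ?_, ?_⟩, a, ?_⟩
  · intro u u' v
    simp only [hβ]
    rw [mulVec_add, add_dotProduct]
  · intro u v v'
    simp only [hβ]
    rw [mulVec_add, star_add, dotProduct_add]
  · intro l u v
    simp only [hβ]
    rw [mulVec_smul, smul_dotProduct, smul_eq_mul]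
  · intro l u v
    simp only [hβ]
    rw [mulVec_smul, star_smul, dotProduct_smul, smul_eq_mul, hstar]
  · intro u v
    rw [← hstar, hβ, hβ]
    exact dotProduct_star_comm _ _
  · intro u hu
    refine mulVec_injective_iff_isUnit.2 hA ?_
    rw [mulVec_zero]
    refine dotProduct_eq_zero _ fun w => ?_
    obtain ⟨v, hv⟩ := mulVec_surjective_iff_isUnit.2 hA (star w)
    have := hu v
    rwa [hβ, hv, star_star] at this
  · intro g u v
    have hg : (ρ g : Matrix (Fin m) (Fin m) K)ᴴ * (Aᴴ * A) * ρ g = Aᴴ * A := (ha g).1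
    have h (u v : Fin m → K) : β u v = u ⬝ᵥ star ((Aᴴ * A) *ᵥ v) := by
      rw [hβ, mulVec_dotProduct_star, mulVec_mulVec]
    rw [h, mulVec_dotProduct_star, mulVec_mulVec, mulVec_mulVec,
      ← mul_assoc, mul_assoc _ Aᴴ, hg, h]
  · refine Subgroup.eq_of_le_of_card_ge ?_ ?_
    · rintro _ ⟨_, ⟨g, rfl⟩, rfl⟩
      let B : Matrix (Fin m) (Fin m) K := (a⁻¹ : GL (Fin m) K)
      have hAB : A * B = 1 := a.mul_inv
      refine (mem_SUgroup_iff hstar).2 ⟨?_, ?_⟩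
      · exact (det_units_conj a _).trans (ha g).2
      · let C : Matrix (Fin m) (Fin m) K := ρ g
        have hg : Cᴴ * (Aᴴ * A) * C = Aᴴ * A := (ha g).1
        change (A * C * B)ᴴ * (A * C * B) = 1
        calc (A * C * B)ᴴ * (A * C * B)
            = Bᴴ * (Cᴴ * (Aᴴ * A) * C) * B := by
              simp only [conjTranspose_mul, mul_assoc]
          _ = (A * B)ᴴ * (A * B) := by
              rw [hg]
              simp only [conjTranspose_mul, mul_assoc]
          _ = 1 := by rw [hAB, conjTranspose_one, mul_one]
    · rw [Subgroup.card_map_of_injective (MulAut.conj a).injective]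
      exact (Nat.card_congr (MonoidHom.ofInjective hρ).toEquiv).le

end SpecialUnitary

end

/-- Let `q` be a prime power, `m ≥ 3`, and `K = 𝔽_{q²}`.  If `ρ : SU_m(q) → GL_m(K)` is
a faithful homomorphism such that `K^m` is an irreducible module under `ρ`, then the
image of `ρ` preserves a nondegenerate Hermitian form on `K^m` (with respect to
`x ↦ x^q`), and hence `ρ(SU_m(q))` is conjugate in `GL_m(K)` to `SU_m(q)`. -/
theorem stmt19 (p b q m : ℕ) (hp : p.Prime) (hb : 0 < b) (hq : q = p ^ b) (hm : 3 ≤ m)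
    (K : Type*) [Field K] [Fintype K] (hK : Fintype.card K = q ^ 2)
    (ρ : ↥(SUgroup K q m) →* Matrix.GeneralLinearGroup (Fin m) K)
    (hfaithful : Function.Injective ρ)
    (hirr : ∀ M : Submodule K (Fin m → K),
      (∀ g : ↥(SUgroup K q m), ∀ v ∈ M,
        Matrix.mulVec ((ρ g : Matrix (Fin m) (Fin m) K)) v ∈ M) →
      M = ⊥ ∨ M = ⊤) :
    (∃ β : (Fin m → K) → (Fin m → K) → K,
      (∀ u u' v, β (u + u') v = β u v + β u' v) ∧
      (∀ u v v', β u (v + v') = β u v + β u v') ∧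
      (∀ (lam : K) u v, β (lam • u) v = lam * β u v) ∧
      (∀ (lam : K) u v, β u (lam • v) = lam ^ q * β u v) ∧
      (∀ u v, β v u = (β u v) ^ q) ∧
      (∀ u, (∀ v, β u v = 0) → u = 0) ∧
      (∀ g : ↥(SUgroup K q m), ∀ u v,
        β (Matrix.mulVec ((ρ g : Matrix (Fin m) (Fin m) K)) u)
          (Matrix.mulVec ((ρ g : Matrix (Fin m) (Fin m) K)) v) = β u v)) ∧
    (∃ t : Matrix.GeneralLinearGroup (Fin m) K,
      Subgroup.map (MulAut.conj t).toMonoidHom (MonoidHom.range ρ) = SUgroup K q m) := by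
  have : Fact p.Prime := ⟨hp⟩
  have hq1 : 1 < q := hq ▸ Nat.one_lt_pow hb.ne' hp.one_lt
  have : CharP K p := by
    have hpr : (ringChar K).Prime := CharP.char_is_prime K (ringChar K)
    have h1 : ringChar K ∣ Fintype.card K :=
      (CharP.cast_eq_zero_iff K (ringChar K) _).1 (Nat.cast_card_eq_zero K)
    rw [hK, hq, ← pow_mul] at h1
    have h2 := (Nat.prime_dvd_prime_iff_eq hpr hp).1 (hpr.dvd_of_dvd_pow h1)
    exact h2 ▸ ringChar.charP K
  have : Nonempty (Fin m) := ⟨⟨0, by omega⟩⟩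
  let _ : StarRing K := powStarRing p b q K hq hK
  have hstar (x : K) : star x = x ^ q := rfl
  have hne : ∃ x : K, star x ≠ x := exists_star_ne hstar hq1 hK
  have he := kerUnitaryDetToSUgroup_surjective (m := m) hstar
  obtain ⟨a, ha⟩ := exists_conjTranspose_mul_invariant hb hq (Nat.card_eq_fintype_card.trans hK)
    hstar hne ((Units.coeHom _).comp (ρ.comp (kerUnitaryDetToSUgroup hstar))) fun M hM =>
      hirr M (he.forall.2 hM)
  exact exists_form_and_conj_eq_SUgroup hstar ρ hfaithful a (he.forall.2 ha)
end
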